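/- Let Γ be a finite simplicial graph. The automorphism group Aut(C_Γ) of the right-angled Coxeter group C_Γ virtually has many quasimorphisms if and only if some vertex of Γ is non-adjacent to at least two other vertices of Γ. -/

import Mathlib

/-- The set of commutation relators defining a graph product. -/
def graphProdRels {V : Type*} (Γ : SimpleGraph V) (G : V → Type*) [∀ w, Group (G w)] :
    Set (Monoid.CoprodI G) :=
  {x | ∃ (u v : V) (_ : Γ.Adj u v) (g : G u) (h : G v),
    x = Monoid.CoprodI.of g * Monoid.CoprodI.of h *
      (Monoid.CoprodI.of g)⁻¹ * (Monoid.CoprodI.of h)⁻¹}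

/-- The graph product of the family of groups `G` over the simplicial graph `Γ`. -/
def GraphProduct {V : Type*} (Γ : SimpleGraph V) (G : V → Type*) [∀ w, Group (G w)] :=
  Monoid.CoprodI G ⧸ Subgroup.normalClosure (graphProdRels Γ G)

instance {V : Type*} (Γ : SimpleGraph V) (G : V → Type*) [∀ w, Group (G w)] :
    Group (GraphProduct Γ G) :=
  inferInstanceAs (Group (Monoid.CoprodI G ⧸ Subgroup.normalClosure (graphProdRels Γ G)))

/-- The canonical map from a vertex group into the graph product. -/
def GraphProduct.of {V : Type*} (Γ : SimpleGraph V) (G : V → Type*) [∀ w, Group (G w)]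
    (u : V) : G u →* GraphProduct Γ G :=
  (QuotientGroup.mk' (Subgroup.normalClosure (graphProdRels Γ G))).comp Monoid.CoprodI.of

/-- The vertex subgroup of the graph product at the vertex `u`. -/
def vertexSubgroup {V : Type*} (Γ : SimpleGraph V) (G : V → Type*) [∀ w, Group (G w)]
    (u : V) : Subgroup (GraphProduct Γ G) :=
  (GraphProduct.of Γ G u).range

/-- An automorphism of the graph product is conjugating if it sends each vertex subgroup to
a conjugate of a vertex subgroup. -/
def IsConjugating {V : Type*} (Γ : SimpleGraph V) (G : V → Type*) [∀ w, Group (G w)]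
    (φ : MulAut (GraphProduct Γ G)) : Prop :=
  ∀ u : V, ∃ (v : V) (g : GraphProduct Γ G),
    Subgroup.map φ.toMonoidHom (vertexSubgroup Γ G u) =
      Subgroup.map (MulAut.conj g).toMonoidHom (vertexSubgroup Γ G v)

/-- An automorphism of the graph product is in `PConjAut` if it sends each vertex subgroup to
a conjugate of itself. -/
def IsPConjugating {V : Type*} (Γ : SimpleGraph V) (G : V → Type*) [∀ w, Group (G w)]
    (φ : MulAut (GraphProduct Γ G)) : Prop :=
  ∀ u : V, ∃ g : GraphProduct Γ G,
    Subgroup.map φ.toMonoidHom (vertexSubgroup Γ G u) =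
      Subgroup.map (MulAut.conj g).toMonoidHom (vertexSubgroup Γ G u)

/-- A vertex is universal if it is adjacent to every other vertex. -/
def IsUniversal {V : Type*} (Γ : SimpleGraph V) (u : V) : Prop :=
  ∀ v : V, v ≠ u → Γ.Adj u v

/-- Some vertex is non-adjacent to at least two other vertices. -/
def HasVertexWithTwoNonNeighbors {V : Type*} (Γ : SimpleGraph V) : Prop :=
  ∃ u v w : V, v ≠ w ∧ v ≠ u ∧ w ≠ u ∧ ¬Γ.Adj u v ∧ ¬Γ.Adj u w

/-- A group `G` is SQ-universal if every countable group embeds into a quotient of `G`. -/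
def SQUniversal (G : Type*) [Group G] : Prop :=
  ∀ (Q : Type) [Group Q] [Countable Q],
    ∃ (N : Subgroup G) (hN : N.Normal),
      haveI := hN
      ∃ f : Q →* G ⧸ N, Function.Injective f

/-- A quasimorphism on a group. -/
def IsQuasimorphism {H : Type*} [Group H] (f : H → ℝ) : Prop :=
  ∃ C : ℝ, 0 ≤ C ∧ ∀ g h : H, |f (g * h) - f g - f h| ≤ C

/-- A homogeneous map on a group. -/
def IsHomogeneous {H : Type*} [Group H] (f : H → ℝ) : Prop :=
  ∀ (g : H) (k : ℤ), f (g ^ k) = (k : ℝ) * f g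

/-- The space of homogeneous quasimorphisms of `H` is infinite-dimensional, expressed as: it is
not contained in the span of any finite set of functions. -/
def HasManyQuasimorphisms (H : Type*) [Group H] : Prop :=
  ¬ ∃ s : Finset (H → ℝ), ∀ f : H → ℝ, IsQuasimorphism f → IsHomogeneous f →
      f ∈ Submodule.span ℝ (s : Set (H → ℝ))

/-- A group virtually has many quasimorphisms if some finite-index subgroup has an
infinite-dimensional space of homogeneous quasimorphisms. -/
def VirtuallyManyQuasimorphisms (G : Type*) [Group G] : Prop :=
  ∃ H : Subgroup G, H.FiniteIndex ∧ HasManyQuasimorphisms H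

/-- A group is boundedly generated if it is the product of finitely many cyclic subgroups. -/
def BoundedlyGenerated (G : Type*) [Group G] : Prop :=
  ∃ l : List G, ∀ g : G, ∃ m : List ℤ, m.length = l.length ∧
    g = (List.zipWith (fun x (k : ℤ) => x ^ k) l m).prod

/-- A group is large if a finite-index subgroup surjects onto a nonabelian free group. -/
def IsLarge (G : Type*) [Group G] : Prop :=
  ∃ H : Subgroup G, H.FiniteIndex ∧ ∃ f : H →* FreeGroup (Fin 2), Function.Surjective f

/-- A group is virtually free abelian if it has a finite-index subgroup isomorphic to `ℤⁿ`. -/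
def VirtuallyFreeAbelian (G : Type*) [Group G] : Prop :=
  ∃ H : Subgroup G, H.FiniteIndex ∧ ∃ n : ℕ, Nonempty (H ≃* Multiplicative (Fin n → ℤ))

/-- The relators of a right-angled Coxeter group. -/
def racgRels {V : Type*} (Γ : SimpleGraph V) : Set (FreeGroup V) :=
  {w | (∃ v : V, w = FreeGroup.of v * FreeGroup.of v) ∨
    ∃ u v : V, Γ.Adj u v ∧ w = (FreeGroup.of u * FreeGroup.of v) ^ 2}

/-- The right-angled Coxeter group of a simplicial graph. -/
def RACG {V : Type*} (Γ : SimpleGraph V) := PresentedGroup (racgRels Γ)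

instance {V : Type*} (Γ : SimpleGraph V) : Group (RACG Γ) :=
  inferInstanceAs (Group (PresentedGroup (racgRels Γ)))

theorem eq_of_forall_abs_mul_sub_mul_le {a b C : ℝ}
    (h : ∀ n : ℕ, |(n : ℝ) * a - n * b| ≤ C) : a = b := by
  by_contra hab
  have hpos : 0 < |a - b| := abs_pos.mpr (sub_ne_zero.mpr hab)
  obtain ⟨n, hn⟩ := exists_nat_gt (C / |a - b|)
  rw [div_lt_iff₀ hpos] at hn
  have := h n
  rw [← mul_sub, abs_mul, Nat.abs_cast] at this
  linarith

/-- A sequence that is additive up to a bounded error is linear up to the same error. -/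
theorem exists_abs_sub_mul_le {a : ℕ → ℝ} {C : ℝ}
    (h : ∀ m n, |a (m + n) - a m - a n| ≤ C) : ∃ L : ℝ, ∀ n : ℕ, |a n - n * L| ≤ C := by
  have hC : 0 ≤ C := (abs_nonneg _).trans (h 0 0)
  have hlin : ∀ n : ℕ, |a n| ≤ n * (|a 1| + C) + C := by
    intro n
    induction n with
    | zero =>
      have := h 0 0
      simp only [add_zero, sub_self, zero_sub, abs_neg] at this
      simpa using this
    | succ n ih =>
      have h1 := h n 1
      push_cast
      have h2 : |a (n + 1)| ≤ |a (n + 1) - a n - a 1| + |a n| + |a 1| := by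
        calc |a (n + 1)| = |(a (n + 1) - a n - a 1) + a n + a 1| := by ring_nf
          _ ≤ _ := (abs_add_le _ _).trans (by gcongr; exact abs_add_le _ _)
      linarith
  have hbdd : ∀ b : ℕ → ℝ, (∀ n, |b n| ≤ n * (|a 1| + C) + 2 * C) →
      BddBelow (Set.range fun n => b n / n) := by
    intro b hb
    refine ⟨-(|a 1| + 3 * C), ?_⟩
    rintro _ ⟨n, rfl⟩
    rcases Nat.eq_zero_or_pos n with rfl | hn
    · simp only [Nat.cast_zero, div_zero]
      have := abs_nonneg (a 1)
      linarith
    · have hn' : (1 : ℝ) ≤ n := by exact_mod_cast hn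
      change _ ≤ b n / n
      rw [le_div_iff₀ (by linarith)]
      have := neg_le_of_abs_le (hb n)
      nlinarith
  have hu : Subadditive fun n => a n + C := fun m n => by
    have := le_of_abs_le (h m n)
    linarith
  have hv : Subadditive fun n => C - a n := fun m n => by
    have := neg_le_of_abs_le (h m n)
    linarith
  have hub := hbdd (fun n => a n + C) fun n => by
    have := abs_add_le (a n) C
    have := hlin n
    rw [abs_of_nonneg hC] at *
    linarith
  have hvb := hbdd (fun n => C - a n) fun n => by
    have := abs_sub C (a n)
    have := hlin n
    rw [abs_of_nonneg hC] at *
    linarith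
  have htu := hu.tendsto_lim hub
  have htv := hv.tendsto_lim hvb
  have hsum : hu.lim + hv.lim = 0 := by
    have h1 := htu.add htv
    have h2 : (fun n : ℕ => (a n + C) / n + (C - a n) / n) = fun n : ℕ => (2 * C) / n := by
      funext n
      ring
    rw [h2] at h1
    exact tendsto_nhds_unique h1 (tendsto_const_div_atTop_nhds_zero_nat _)
  refine ⟨hu.lim, fun n => ?_⟩
  rcases Nat.eq_zero_or_pos n with rfl | hn
  · have := hlin 0
    simpa using this
  · have hn' : (0 : ℝ) < n := by exact_mod_cast hn
    have h1 := hu.lim_le_div hub hn.ne'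
    have h2 := hv.lim_le_div hvb hn.ne'
    rw [le_div_iff₀ hn'] at h1 h2
    rw [abs_le]
    constructor <;> nlinarith

/-- Every quasimorphism is at bounded distance from a homogeneous one. -/
theorem IsQuasimorphism.exists_homogeneous {G : Type*} [Group G] {F : G → ℝ}
    (hF : IsQuasimorphism F) :
    ∃ f : G → ℝ, IsQuasimorphism f ∧ IsHomogeneous f ∧ ∃ C, ∀ g, |f g - F g| ≤ C := by
  obtain ⟨C, hC, hF⟩ := hF
  have hex : ∀ g, ∃ L : ℝ, ∀ n : ℕ, |F (g ^ n) - n * L| ≤ C := fun g =>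
    exists_abs_sub_mul_le fun m n => by rw [pow_add]; exact hF _ _
  choose f hf using hex
  have hclose : ∀ g, |f g - F g| ≤ C := fun g => by
    have := hf g 1
    rw [abs_sub_comm]
    simpa using this
  have hone : |F 1| ≤ C := by
    have := hF 1 1
    simpa using this
  have hzpow : ∀ g (k : ℤ), |F (g ^ k) - k * f g| ≤ 3 * C := by
    intro g k
    obtain ⟨n, rfl | rfl⟩ := k.eq_nat_or_neg
    · have := hf g n
      rw [zpow_natCast, Int.cast_natCast]
      linarith
    · have h1 := abs_le.mp (hf g n)
      have h2 := abs_le.mp (hF (g ^ n) (g ^ n)⁻¹)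
      rw [mul_inv_cancel] at h2
      have h3 := abs_le.mp hone
      rw [zpow_neg, zpow_natCast, Int.cast_neg, Int.cast_natCast, abs_le]
      constructor <;> linarith [h1.1, h1.2, h2.1, h2.2, h3.1, h3.2]
  refine ⟨f, ⟨4 * C, by linarith, fun g h => ?_⟩, fun g k => ?_, C, hclose⟩
  · have h1 := abs_le.mp (hclose g)
    have h2 := abs_le.mp (hclose h)
    have h3 := abs_le.mp (hclose (g * h))
    have h4 := abs_le.mp (hF g h)
    rw [abs_le]
    constructor <;> linarith [h1.1, h1.2, h2.1, h2.2, h3.1, h3.2, h4.1, h4.2]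
  · refine eq_of_forall_abs_mul_sub_mul_le (C := 4 * C) fun n => ?_
    have h1 := abs_le.mp (hf (g ^ k) n)
    have h2 := abs_le.mp (hzpow g (k * n))
    rw [zpow_mul, zpow_natCast] at h2
    push_cast at h2
    rw [abs_le]
    constructor <;> linarith [h1.1, h1.2, h2.1, h2.2]

theorem IsQuasimorphism.comp {G H : Type*} [Group G] [Group H] {F : G → ℝ}
    (hF : IsQuasimorphism F) (θ : H →* G) : IsQuasimorphism (F ∘ θ) := by
  obtain ⟨C, hC, hF⟩ := hF
  exact ⟨C, hC, fun g h => by simpa using hF (θ g) (θ h)⟩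

theorem IsHomogeneous.comp {G H : Type*} [Group G] [Group H] {F : G → ℝ}
    (hF : IsHomogeneous F) (θ : H →* G) : IsHomogeneous (F ∘ θ) := fun g k => by
  simpa using hF (θ g) k

/-- A group carrying homogeneous quasimorphisms dual to an infinite sequence of elements has many
quasimorphisms. -/
theorem hasManyQuasimorphisms_of_dual {H : Type*} [Group H] (f : ℕ → H → ℝ) (g : ℕ → H)
    (hq : ∀ n, IsQuasimorphism (f n)) (hh : ∀ n, IsHomogeneous (f n))
    (hne : ∀ n, f n (g n) ≠ 0) (hzero : ∀ m n, m ≠ n → f m (g n) = 0) :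
    HasManyQuasimorphisms H := by
  rintro ⟨s, hs⟩
  have hli : LinearIndependent ℝ f := by
    rw [linearIndependent_iff']
    intro t c hc n hn
    have h := congrFun hc (g n)
    rw [Finset.sum_apply, Finset.sum_eq_single n] at h
    · simpa [hne n] using h
    · intro m _ hm
      simp [hzero m n hm]
    · exact fun h => absurd hn h
  have hli' : LinearIndependent ℝ fun n =>
      (⟨f n, hs _ (hq n) (hh n)⟩ : Submodule.span ℝ (s : Set (H → ℝ))) :=
    LinearIndependent.of_comp (Submodule.subtype _) hli
  have : Module.Finite ℝ (Submodule.span ℝ (s : Set (H → ℝ))) :=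
    Module.Finite.span_finset ℝ s
  exact not_finite_iff_infinite.mpr (inferInstanceAs (Infinite ℕ)) hli'.finite

/-- The number of occurrences of the word `w` as a block of consecutive letters. -/
def List.countBlock {β : Type*} [DecidableEq β] (w : List β) : List β → ℕ
  | [] => 0
  | x :: l => (if w <+: x :: l then 1 else 0) + List.countBlock w l

namespace List

variable {β : Type*} [DecidableEq β]

theorem countBlock_append_le (w l₁ l₂ : List β) :
    countBlock w l₁ + countBlock w l₂ ≤ countBlock w (l₁ ++ l₂) := by
  induction l₁ with
  | nil => simp [countBlock]
  | cons x l ih =>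
    simp only [countBlock, cons_append]
    have : w <+: x :: l → w <+: x :: (l ++ l₂) := fun h => h.trans (prefix_append (x :: l) l₂)
    split_ifs <;> first | omega | (exfalso; tauto)

theorem le_countBlock_append (w l₁ l₂ : List β) :
    countBlock w (l₁ ++ l₂) ≤ countBlock w l₁ + countBlock w l₂ + min w.length l₁.length := by
  induction l₁ with
  | nil => simp [countBlock]
  | cons x l ih =>
    simp only [countBlock, cons_append, length_cons]
    by_cases hlen : w.length ≤ l.length + 1
    · have : w <+: x :: (l ++ l₂) → w <+: x :: l := fun h =>
        prefix_of_prefix_length_le h (prefix_append (x :: l) l₂) (by simpa using hlen)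
      have hmin : min w.length l.length ≤ min w.length (l.length + 1) := by omega
      split_ifs <;> first | omega | (exfalso; tauto)
    · have hmin : min w.length (l.length + 1) = min w.length l.length + 1 := by omega
      split_ifs <;> omega

theorem countBlock_eq_zero_of_notMem {w l : List β} {x : β} (hx : x ∈ w) (hl : x ∉ l) :
    countBlock w l = 0 := by
  induction l with
  | nil => rfl
  | cons y l ih =>
    have : ¬ w <+: y :: l := fun h => hl (h.subset hx)
    simp only [countBlock, if_neg this, zero_add]
    exact ih fun h => hl (mem_cons_of_mem _ h)

end List

namespace FreeGroup

variable {α : Type*} [DecidableEq α]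

/-- The product of two reduced words is obtained by cancelling a common block. -/
theorem exists_toWord_mul (g h : FreeGroup α) : ∃ a k b : List (α × Bool),
    g.toWord = a ++ k ∧ h.toWord = invRev k ++ b ∧ (g * h).toWord = a ++ b := by
  have key : ∀ (n : ℕ) (L₁ L₂ : List (α × Bool)), L₁.length = n → IsReduced L₁ → IsReduced L₂ →
      ∃ a k b, L₁ = a ++ k ∧ L₂ = invRev k ++ b ∧ reduce (L₁ ++ L₂) = a ++ b := by
    intro n
    induction n with
    | zero =>
      intro L₁ L₂ hn _ h₂
      rw [List.length_eq_zero_iff] at hn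
      subst hn
      exact ⟨[], [], L₂, rfl, rfl, by simpa using h₂.reduce_eq⟩
    | succ n ih =>
      intro L₁ L₂ hn h₁ h₂
      by_cases hred : IsReduced (L₁ ++ L₂)
      · exact ⟨L₁, [], L₂, by simp, by simp, hred.reduce_eq⟩
      obtain ⟨L, ⟨i, s⟩, rfl⟩ : ∃ L x, L₁ = L ++ [x] :=
        ⟨L₁.dropLast, L₁.getLast (by rintro rfl; simp at hn), (List.dropLast_append_getLast _).symm⟩
      cases L₂ with
      | nil => simp [h₁] at hred
      | cons y M =>
        obtain ⟨j, t⟩ := y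
        have hcancel : (j, t) = (i, !s) := by
          by_contra hne
          apply hred
          unfold IsReduced at *
          rw [List.isChain_append]
          refine ⟨h₁, h₂, ?_⟩
          simp only [List.getLast?_concat, Option.mem_def, List.head?_cons, Option.some.injEq]
          rintro _ rfl _ rfl hij
          simp only at hij
          subst hij
          by_contra hst
          exact hne (by simp; cases s <;> cases t <;> simp_all)
        obtain ⟨rfl, rfl⟩ := Prod.mk.inj hcancel
        have hn' : L.length = n := by simpa using hn
        have hL : IsReduced L := List.IsChain.left_of_append h₁
        have hM : IsReduced M := List.IsChain.tail h₂
        obtain ⟨a, k, b, rfl, rfl, hab⟩ := ih L M hn' hL hM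
        refine ⟨a, k ++ [(j, s)], b, by simp, by simp [invRev], ?_⟩
        rw [← hab]
        apply reduce.Step.eq
        have := @Red.Step.not _ (a ++ k) (invRev k ++ b) j s
        simpa using this
  obtain ⟨a, k, b, h₁, h₂, h₃⟩ :=
    key _ g.toWord h.toWord rfl isReduced_toWord isReduced_toWord
  exact ⟨a, k, b, h₁, h₂, by rw [toWord_mul, h₃]⟩

/-- The counting function of a word, antisymmetrised. -/
def brooks (w : List (α × Bool)) (g : FreeGroup α) : ℝ :=
  List.countBlock w g.toWord - List.countBlock w (invRev g.toWord)

theorem isQuasimorphism_brooks (w : List (α × Bool)) : IsQuasimorphism (brooks w) := by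
  have hc : ∀ l₁ l₂ : List (α × Bool),
      |(List.countBlock w (l₁ ++ l₂) : ℝ) - List.countBlock w l₁ - List.countBlock w l₂|
        ≤ w.length := by
    intro l₁ l₂
    have h1 := List.countBlock_append_le w l₁ l₂
    have h2 := (List.le_countBlock_append w l₁ l₂).trans
      (Nat.add_le_add_left (min_le_left _ _) _)
    have h1' : (List.countBlock w l₁ : ℝ) + List.countBlock w l₂ ≤
      List.countBlock w (l₁ ++ l₂) := by exact_mod_cast h1
    have h2' : (List.countBlock w (l₁ ++ l₂) : ℝ) ≤
      List.countBlock w l₁ + List.countBlock w l₂ + w.length := by exact_mod_cast h2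
    rw [abs_le]
    constructor <;> linarith
  have hinv : ∀ l₁ l₂ : List (α × Bool), invRev (l₁ ++ l₂) = invRev l₂ ++ invRev l₁ := by
    intro l₁ l₂
    simp [invRev]
  refine ⟨6 * w.length, by positivity, fun g h => ?_⟩
  obtain ⟨a, k, b, hg, hh, hgh⟩ := exists_toWord_mul g h
  simp only [brooks, hg, hh, hgh, hinv, invRev_invRev]
  have h1 := abs_le.mp (hc a k)
  have h2 := abs_le.mp (hc (invRev k) b)
  have h3 := abs_le.mp (hc a b)
  have h4 := abs_le.mp (hc (invRev k) (invRev a))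
  have h5 := abs_le.mp (hc (invRev b) k)
  have h6 := abs_le.mp (hc (invRev b) (invRev a))
  rw [abs_le]
  constructor <;> linarith [h1.1, h1.2, h2.1, h2.2, h3.1, h3.2, h4.1, h4.2, h5.1, h5.2, h6.1, h6.2]

end FreeGroup

namespace List

theorem replicate_append_singleton_prefix_iff {β : Type*} {x y : β} (hxy : x ≠ y) (n m k : ℕ) :
    replicate n y ++ [x] <+: replicate m y ++ (replicate k (x :: replicate m y)).flatten ↔
      n = m ∧ 0 < k := by
  generalize hl : (replicate k (x :: replicate m y)).flatten = l
  have hl' : (l = [] ∧ k = 0) ∨ (0 < k ∧ ∃ l', l = x :: l') := by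
    cases k with
    | zero => left; simpa using hl.symm
    | succ k => right; exact ⟨k.succ_pos, _, by rw [← hl, replicate_succ, flatten_cons]; rfl⟩
  clear hl
  induction n generalizing m with
  | zero =>
    cases m with
    | zero => rcases hl' with ⟨rfl, rfl⟩ | ⟨hk, l', rfl⟩ <;> simp_all
    | succ m => simp [replicate_succ, hxy]
  | succ n ih =>
    cases m with
    | zero =>
      rcases hl' with ⟨rfl, rfl⟩ | ⟨hk, l', rfl⟩
      · simp
      · simp [replicate_succ, hxy.symm]
    | succ m =>
      simp only [replicate_succ, cons_append, cons_prefix_cons, true_and, ih m, Nat.succ_inj]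

variable {β : Type*} [DecidableEq β]

theorem countBlock_replicate_append {x y : β} (hxy : x ≠ y) (v : List β) (j : ℕ) (l : List β) :
    countBlock (x :: v) (replicate j y ++ l) = countBlock (x :: v) l := by
  induction j with
  | zero => rfl
  | succ j ih =>
    simp only [replicate_succ, cons_append, countBlock, cons_prefix_cons, hxy, false_and,
      if_false, zero_add, ih]

theorem countBlock_flatten_replicate {x y : β} (hxy : x ≠ y) (n m k : ℕ) :
    countBlock (x :: (replicate n y ++ [x])) (replicate k (x :: replicate m y)).flatten =
      if n = m then k - 1 else 0 := by
  induction k with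
  | zero => simp [countBlock]
  | succ k ih =>
    rw [replicate_succ, flatten_cons, cons_append, countBlock,
      countBlock_replicate_append hxy, ih]
    simp only [cons_prefix_cons, true_and, replicate_append_singleton_prefix_iff hxy]
    by_cases h : n = m
    · simp only [h, true_and, if_true]
      split_ifs <;> omega
    · simp [h]

end List

namespace FreeGroup

theorem isReduced_of_forall_snd {α : Type*} {l : List (α × Bool)} {b : Bool}
    (h : ∀ x ∈ l, x.2 = b) : IsReduced l := by
  refine List.Pairwise.isChain ?_
  refine List.Pairwise.imp_of_mem (R := fun _ _ => True) ?_ ?_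
  · intro x y hx hy _ _
    rw [h x hx, h y hy]
  · simp [List.pairwise_iff_forall_sublist]

theorem toWord_pow_of_mul_pow (m k : ℕ) :
    ((of true * of false ^ m : FreeGroup Bool) ^ k).toWord =
      (List.replicate k ((true, true) :: List.replicate m (false, true))).flatten := by
  have hmk : ((of true * of false ^ m : FreeGroup Bool) ^ k) =
      mk (List.replicate k ((true, true) :: List.replicate m (false, true))).flatten := by
    have h1 : (of false : FreeGroup Bool) ^ m = mk (List.replicate m (false, true)) := by
      rw [← toWord_of_pow, mk_toWord]
    rw [h1, of, mul_mk, ← pow_mk]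
    rfl
  rw [hmk, toWord_mk]
  apply IsReduced.reduce_eq
  apply isReduced_of_forall_snd (b := true)
  intro x hx
  simp only [List.mem_flatten, List.mem_replicate] at hx
  obtain ⟨_, ⟨_, rfl⟩, hx⟩ := hx
  simp only [List.mem_cons, List.mem_replicate] at hx
  rcases hx with rfl | ⟨_, rfl⟩ <;> rfl

theorem brooks_pow_of_mul_pow (n m k : ℕ) :
    brooks ((true, true) :: (List.replicate n (false, true) ++ [(true, true)]))
      ((of true * of false ^ m : FreeGroup Bool) ^ k) = if n = m then ((k - 1 : ℕ) : ℝ) else 0 := by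
  rw [brooks, toWord_pow_of_mul_pow, List.countBlock_flatten_replicate (by simp),
    List.countBlock_eq_zero_of_notMem (x := (true, true)) (by simp)]
  · split_ifs <;> simp
  · intro h
    simp only [invRev, List.mem_reverse, List.mem_map, List.mem_flatten, List.mem_replicate] at h
    obtain ⟨x, ⟨_, ⟨_, rfl⟩, hx⟩, hx'⟩ := h
    simp only [List.mem_cons, List.mem_replicate] at hx
    rcases hx with rfl | ⟨_, rfl⟩ <;> simp at hx'

/-- Homogeneous quasimorphisms on the free group of rank two dual to the elements
`of true * of false ^ n`. -/
theorem exists_dual_quasimorphisms : ∃ f : ℕ → FreeGroup Bool → ℝ,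
    (∀ n, IsQuasimorphism (f n)) ∧ (∀ n, IsHomogeneous (f n)) ∧
    ∀ n m, f n (of true * of false ^ m) = if n = m then 1 else 0 := by
  choose f hq hh C hC using fun n : ℕ => (isQuasimorphism_brooks
    ((true, true) :: (List.replicate n (false, true) ++ [(true, true)]))).exists_homogeneous
  refine ⟨f, hq, hh, fun n m => ?_⟩
  refine eq_of_forall_abs_mul_sub_mul_le (C := C n + 1) fun k => ?_
  have h1 := hC n ((of true * of false ^ m) ^ k)
  rw [brooks_pow_of_mul_pow] at h1
  have h2 := hh n (of true * of false ^ m) k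
  rw [zpow_natCast, Int.cast_natCast] at h2
  rw [h2] at h1
  split_ifs at h1 ⊢ with h
  · rcases Nat.eq_zero_or_pos k with rfl | hk
    · have := (abs_nonneg _).trans h1
      simp
      linarith
    · rw [Nat.cast_sub hk, Nat.cast_one] at h1
      rw [abs_le] at *
      constructor <;> linarith [h1.1, h1.2]
  · rw [mul_zero]
    linarith

end FreeGroup

/-- A group with a finite-index subgroup mapping to a free group of rank two, with image meeting
every cyclic subgroup in a nontrivial power, virtually has many quasimorphisms. -/
theorem virtuallyManyQuasimorphisms_of_hom {G : Type*} [Group G] (H : Subgroup G)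
    [H.FiniteIndex] (θ : H →* FreeGroup Bool)
    (hθ : ∀ w : FreeGroup Bool, ∃ n : ℕ, n ≠ 0 ∧ w ^ n ∈ θ.range) :
    VirtuallyManyQuasimorphisms G := by
  obtain ⟨f, hq, hh, hf⟩ := FreeGroup.exists_dual_quasimorphisms
  choose k hk hrange using hθ
  choose g hg using hrange
  refine ⟨H, inferInstance, hasManyQuasimorphisms_of_dual (fun n => f n ∘ θ)
    (fun n => g (FreeGroup.of true * FreeGroup.of false ^ n))
    (fun n => (hq n).comp θ) (fun n => (hh n).comp θ) ?_ ?_⟩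
  all_goals
    intros
    simp only [Function.comp_apply, hg]
    rw [← zpow_natCast, hh, hf]
    simp [*]

namespace RACG

variable {V : Type*} {Γ : SimpleGraph V}

/-- The generator of a right-angled Coxeter group attached to a vertex. -/
def gen (Γ : SimpleGraph V) (v : V) : RACG Γ :=
  PresentedGroup.of v

@[simp]
theorem gen_mul_gen (v : V) : gen Γ v * gen Γ v = 1 :=
  PresentedGroup.one_of_mem (rels := racgRels Γ) (x := FreeGroup.of v * FreeGroup.of v)
    (Or.inl ⟨v, rfl⟩)

@[simp]
theorem gen_inv (v : V) : (gen Γ v)⁻¹ = gen Γ v :=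
  inv_eq_of_mul_eq_one_left (gen_mul_gen v)

theorem commute_gen {u v : V} (h : Γ.Adj u v) : Commute (gen Γ u) (gen Γ v) := by
  have h1 : (gen Γ u * gen Γ v) ^ 2 = 1 :=
    PresentedGroup.one_of_mem (rels := racgRels Γ) (x := (FreeGroup.of u * FreeGroup.of v) ^ 2)
      (Or.inr ⟨u, v, h, rfl⟩)
  have h2 : gen Γ u * gen Γ v = (gen Γ u * gen Γ v)⁻¹ :=
    eq_inv_of_mul_eq_one_left (by rw [← sq, h1])
  rwa [mul_inv_rev, gen_inv, gen_inv] at h2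

/-- The homomorphism out of a right-angled Coxeter group determined by the images of the
generators. -/
def lift {G : Type*} [Group G] (f : V → G) (h₁ : ∀ v, f v * f v = 1)
    (h₂ : ∀ u v, Γ.Adj u v → Commute (f u) (f v)) : RACG Γ →* G :=
  PresentedGroup.toGroup (rels := racgRels Γ) (f := f) (by
    rintro _ (⟨v, rfl⟩ | ⟨u, v, huv, rfl⟩)
    · simp [h₁]
    · have := h₂ u v huv
      rw [map_pow, map_mul, FreeGroup.lift_apply_of, FreeGroup.lift_apply_of, this.mul_pow, sq, sq,
        h₁, h₁, one_mul])

@[simp]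
theorem lift_gen {G : Type*} [Group G] (f : V → G) (h₁ : ∀ v, f v * f v = 1)
    (h₂ : ∀ u v, Γ.Adj u v → Commute (f u) (f v)) (v : V) : lift f h₁ h₂ (gen Γ v) = f v :=
  PresentedGroup.toGroup.of _

theorem hom_ext {G : Type*} [Group G] {φ ψ : RACG Γ →* G}
    (h : ∀ v, φ (gen Γ v) = ψ (gen Γ v)) : φ = ψ :=
  PresentedGroup.ext h

theorem closure_range_gen : Subgroup.closure (Set.range (gen Γ)) = ⊤ :=
  PresentedGroup.closure_range_of _

/-- The automorphisms of a right-angled Coxeter group that act trivially on its abelianization. -/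
def torelli (Γ : SimpleGraph V) : Subgroup (MulAut (RACG Γ)) where
  carrier := {φ | ∀ (χ : RACG Γ →* ℤˣ) (g : RACG Γ), χ (φ g) = χ g}
  mul_mem' hφ hψ χ g := by rw [MulAut.mul_apply, hφ, hψ]
  one_mem' χ g := rfl
  inv_mem' {φ} hφ χ g := by rw [← hφ χ (φ⁻¹ g), MulAut.apply_inv_self]

instance [Finite V] : (torelli Γ).FiniteIndex := by
  have hfin : Finite (RACG Γ →* ℤˣ) :=
    Finite.of_injective (fun χ v => χ (gen Γ v)) fun χ ψ h => hom_ext (congrFun h)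
  let act : MulAut (RACG Γ) →* Equiv.Perm (RACG Γ →* ℤˣ) :=
    { toFun := fun φ =>
        { toFun := fun χ => χ.comp (φ⁻¹).toMonoidHom
          invFun := fun χ => χ.comp φ.toMonoidHom
          left_inv := fun χ => by ext g; simp
          right_inv := fun χ => by ext g; simp }
      map_one' := by ext; rfl
      map_mul' := fun φ ψ => by ext; simp [mul_inv_rev] }
  have hker : act.ker ≤ torelli Γ := by
    intro φ hφ χ g
    have h := DFunLike.congr_fun (Equiv.congr_fun (MonoidHom.mem_ker.mp hφ) χ) (φ g)
    simpa [act] using h.symm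
  exact Subgroup.finiteIndex_of_le hker

theorem conj_mem_torelli (g : RACG Γ) : MulAut.conj g ∈ torelli Γ := fun χ x => by
  rw [MulAut.conj_apply, map_mul, map_mul, map_inv, mul_right_comm, mul_inv_cancel, one_mul]

end RACG

namespace RACG

variable {V : Type*} {Γ : SimpleGraph V}

/-- The homomorphism out of a right-angled Coxeter group determined by the images of some of the
generators, the other generators being sent to `1`. -/
noncomputable def extendLift {κ G : Type*} [Group G] (s : κ → V) (hs : Function.Injective s)
    (f : κ → G) (h₁ : ∀ k, f k * f k = 1)
    (h₂ : ∀ k l, Γ.Adj (s k) (s l) → Commute (f k) (f l)) : RACG Γ →* G :=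
  lift (Function.extend s f 1)
    (fun v => by
      by_cases hv : ∃ k, s k = v
      · obtain ⟨k, rfl⟩ := hv
        rw [hs.extend_apply, h₁]
      · rw [Function.extend_apply' _ _ _ hv, Pi.one_apply, one_mul])
    (fun u v huv => by
      by_cases hv : ∃ k, s k = v
      · by_cases hu : ∃ k, s k = u
        · obtain ⟨k, rfl⟩ := hv
          obtain ⟨l, rfl⟩ := hu
          rw [hs.extend_apply, hs.extend_apply]
          exact h₂ _ _ huv
        · rw [Function.extend_apply' _ _ _ hu]
          exact Commute.one_left _
      · rw [Function.extend_apply' _ _ _ hv]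
        exact Commute.one_right _)

section

variable {κ G : Type*} [Group G] {s : κ → V} {hs : Function.Injective s}
  {f : κ → G} {h₁ : ∀ k, f k * f k = 1}
  {h₂ : ∀ k l, Γ.Adj (s k) (s l) → Commute (f k) (f l)}

@[simp]
theorem extendLift_gen (k : κ) : extendLift s hs f h₁ h₂ (gen Γ (s k)) = f k := by
  rw [extendLift, lift_gen, hs.extend_apply]

theorem extendLift_gen_of_notMem {v : V} (hv : ¬ ∃ k, s k = v) :
    extendLift s hs f h₁ h₂ (gen Γ v) = 1 := by
  rw [extendLift, lift_gen, Function.extend_apply' _ _ _ hv, Pi.one_apply]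

end

end RACG

/-- The group of isometries `x ↦ ± x + v` of the lattice `ℤ^ι`. -/
@[ext]
structure SignedTranslation (ι : Type*) where
  /-- The translation part. -/
  vec : ι → ℤ
  /-- The linear part. -/
  sgn : ℤˣ

namespace SignedTranslation

variable {ι : Type*}

instance : Mul (SignedTranslation ι) := ⟨fun x y => ⟨x.vec + (x.sgn : ℤ) • y.vec, x.sgn * y.sgn⟩⟩
instance : One (SignedTranslation ι) := ⟨⟨0, 1⟩⟩
instance : Inv (SignedTranslation ι) := ⟨fun x => ⟨-((x.sgn : ℤ) • x.vec), x.sgn⟩⟩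

@[simp] theorem mul_vec (x y : SignedTranslation ι) :
    (x * y).vec = x.vec + (x.sgn : ℤ) • y.vec := rfl
@[simp] theorem mul_sgn (x y : SignedTranslation ι) : (x * y).sgn = x.sgn * y.sgn := rfl
@[simp] theorem one_vec : (1 : SignedTranslation ι).vec = 0 := rfl
@[simp] theorem one_sgn : (1 : SignedTranslation ι).sgn = 1 := rfl

instance : Group (SignedTranslation ι) :=
  Group.ofLeftAxioms
    (fun x y z => by ext <;> simp [mul_smul, smul_add, mul_assoc, add_assoc])
    (fun x => by ext <;> simp)
    (fun x => by
      have h : (x⁻¹ : SignedTranslation ι) = ⟨-((x.sgn : ℤ) • x.vec), x.sgn⟩ := rfl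
      rw [h]
      ext <;> simp)

/-- The linear part as a homomorphism. -/
def sgnHom (ι : Type*) : SignedTranslation ι →* ℤˣ where
  toFun := sgn
  map_one' := rfl
  map_mul' _ _ := rfl

theorem eq_one_of_sgn {x : SignedTranslation ι} (h : x.sgn = 1) (hx : x * x = 1) : x = 1 := by
  have h1 := congrArg vec hx
  ext j
  · have := congrFun h1 j
    simp [h] at this
    simp only [one_vec, Pi.zero_apply]
    omega
  · rw [h, one_sgn]

/-- The endomorphism with given linear action on translations and given image of the central
symmetry. -/
def endOfMatrix [Fintype ι] (M : Matrix ι ι ℤ) (τ : ι → ℤ) :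
    SignedTranslation ι →* SignedTranslation ι where
  toFun x := ⟨M.mulVec x.vec + if x.sgn = 1 then 0 else τ, x.sgn⟩
  map_one' := by ext <;> simp
  map_mul' x y := by
    ext j
    · obtain ⟨v, ε⟩ := x
      obtain ⟨w, δ⟩ := y
      rcases Int.units_eq_one_or ε with rfl | rfl <;> rcases Int.units_eq_one_or δ with rfl | rfl
      all_goals
        simp [Matrix.mulVec_add, Matrix.mulVec_neg]
      all_goals ring
    · simp

end SignedTranslation

namespace RACG

open SignedTranslation

variable {V : Type*} {Γ : SimpleGraph V} {ι : Type*} [DecidableEq ι]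

/-- The homomorphism to a lattice extended by its central symmetry that is attached to a family of
pairwise non-adjacent vertices with a base point. -/
noncomputable def latticeProj (s : Option ι → V) (hs : Function.Injective s)
    (hind : ∀ k l, ¬ Γ.Adj (s k) (s l)) : RACG Γ →* SignedTranslation ι :=
  extendLift s hs (fun k => ⟨k.elim 0 fun i => Pi.single i 1, -1⟩)
    (fun k => by ext <;> simp) (fun k l h => absurd h (hind k l))

variable {s : Option ι → V} {hs : Function.Injective s} {hind : ∀ k l, ¬ Γ.Adj (s k) (s l)}

@[simp]
theorem latticeProj_gen_some (i : ι) :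
    latticeProj s hs hind (gen Γ (s (some i))) = ⟨Pi.single i 1, -1⟩ :=
  extendLift_gen _

@[simp]
theorem latticeProj_gen_none : latticeProj s hs hind (gen Γ (s none)) = ⟨0, -1⟩ :=
  extendLift_gen _

theorem latticeProj_gen_of_notMem {v : V} (hv : ¬ ∃ k, s k = v) :
    latticeProj s hs hind (gen Γ v) = 1 :=
  extendLift_gen_of_notMem hv

theorem sgn_latticeProj_of_mem_torelli {φ : MulAut (RACG Γ)} (hφ : φ ∈ torelli Γ) (g : RACG Γ) :
    (latticeProj s hs hind (φ g)).sgn = (latticeProj s hs hind g).sgn :=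
  hφ ((sgnHom ι).comp (latticeProj s hs hind)) g

variable [Fintype ι]

variable (s hs hind) in
/-- The matrix of the action of an automorphism on the lattice. -/
noncomputable def latticeMatrix (φ : MulAut (RACG Γ)) : Matrix ι ι ℤ :=
  Matrix.of fun j i => (latticeProj s hs hind (φ (gen Γ (s (some i)) * gen Γ (s none)))).vec j

theorem latticeProj_apply_of_mem_torelli {φ : MulAut (RACG Γ)} (hφ : φ ∈ torelli Γ) (g : RACG Γ) :
    latticeProj s hs hind (φ g) =
      endOfMatrix (latticeMatrix s hs hind φ) (latticeProj s hs hind (φ (gen Γ (s none)))).vec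
        (latticeProj s hs hind g) := by
  have hsgn := fun g => sgn_latticeProj_of_mem_torelli (s := s) (hs := hs) (hind := hind) hφ g
  refine DFunLike.congr_fun (f := (latticeProj s hs hind).comp φ.toMonoidHom)
    (g := (endOfMatrix _ _).comp (latticeProj s hs hind)) (hom_ext fun v => ?_) g
  simp only [MonoidHom.comp_apply, MulEquiv.toMonoidHom_eq_coe, MonoidHom.coe_coe]
  by_cases hv : ∃ k, s k = v
  · obtain ⟨k, rfl⟩ := hv
    cases k with
    | none =>
      rw [latticeProj_gen_none]
      ext
      · simp [endOfMatrix]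
      · rw [hsgn]
        simp [endOfMatrix]
    | some i =>
      rw [latticeProj_gen_some]
      ext j
      · have h1 := hsgn (gen Γ (s (some i)))
        rw [latticeProj_gen_some] at h1
        simp [endOfMatrix, latticeMatrix, h1]
      · rw [hsgn]
        simp [endOfMatrix]
  · rw [latticeProj_gen_of_notMem hv, map_one]
    refine eq_one_of_sgn ?_ ?_
    · rw [hsgn, latticeProj_gen_of_notMem hv, one_sgn]
    · rw [← map_mul, ← map_mul, gen_mul_gen, map_one, map_one]

variable (s hs hind) in
/-- The action of the Torelli subgroup on the lattice. -/
noncomputable def latticeHom : torelli Γ →* Matrix ι ι ℤ where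
  toFun φ := latticeMatrix s hs hind φ
  map_one' := by
    ext j i
    simp [latticeMatrix, Matrix.one_apply, Pi.single_apply]
  map_mul' φ ψ := by
    ext j i
    have h1 : (latticeProj s hs hind (ψ.1 (gen Γ (s (some i)) * gen Γ (s none)))).sgn = 1 := by
      rw [sgn_latticeProj_of_mem_torelli ψ.2]
      simp
    have h2 := latticeProj_apply_of_mem_torelli (s := s) (hs := hs) (hind := hind) φ.2
      (ψ.1 (gen Γ (s (some i)) * gen Γ (s none)))
    have h3 := congrFun (congrArg vec h2) j
    simp only [endOfMatrix, MonoidHom.coe_mk, OneHom.coe_mk, h1, if_true, add_zero] at h3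
    rw [Matrix.mul_apply]
    exact h3

end RACG

theorem IsQuasimorphism.map_mul_of_commute {G : Type*} [Group G] {f : G → ℝ}
    (hq : IsQuasimorphism f) (hh : IsHomogeneous f) {g h : G} (hgh : Commute g h) :
    f (g * h) = f g + f h := by
  obtain ⟨C, -, hC⟩ := hq
  refine eq_of_forall_abs_mul_sub_mul_le (C := C) fun n => ?_
  have h1 := hC (g ^ n) (h ^ n)
  have hn (x : G) : f (x ^ n) = n * f x := by simpa using hh x n
  rw [← hgh.mul_pow, hn, hn, hn] at h1
  rwa [mul_add, ← sub_sub]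

/-- The space of homogeneous quasimorphisms. -/
def homogeneousQuasimorphisms (H : Type*) [Group H] : Submodule ℝ (H → ℝ) where
  carrier := {f | IsQuasimorphism f ∧ IsHomogeneous f}
  zero_mem' := ⟨⟨0, le_rfl, fun g h => by simp⟩, fun g k => by simp⟩
  add_mem' := by
    rintro f₁ f₂ ⟨⟨C₁, h₁, hC₁⟩, hh₁⟩ ⟨⟨C₂, h₂, hC₂⟩, hh₂⟩
    refine ⟨⟨C₁ + C₂, by linarith, fun g h => ?_⟩, fun g k => ?_⟩
    · have := abs_le.mp (hC₁ g h)
      have := abs_le.mp (hC₂ g h)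
      simp only [Pi.add_apply]
      rw [abs_le]
      constructor <;> linarith
    · simp only [Pi.add_apply, hh₁ g k, hh₂ g k]
      ring
  smul_mem' := by
    rintro c f ⟨⟨C, h, hC⟩, hh⟩
    refine ⟨⟨|c| * C, by positivity, fun g h => ?_⟩, fun g k => ?_⟩
    · simp only [Pi.smul_apply, smul_eq_mul]
      rw [← mul_sub, ← mul_sub, abs_mul]
      exact mul_le_mul_of_nonneg_left (hC g h) (abs_nonneg c)
    · simp only [Pi.smul_apply, smul_eq_mul, hh g k]
      ring

theorem fg_of_injective_lattice {Q ι : Type*} [Group Q] [Finite ι]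
    {τ : Q →* Multiplicative (ι → ℤ)} (hτ : Function.Injective τ) : Group.FG Q := by
  have hr : τ.range.FG := by
    rw [Subgroup.fg_iff_add_fg]
    exact (AddSubgroup.fg_iff_addSubmonoid_fg _).mpr
      ((AddSubgroup.fg_iff_addSubmonoid_fg _).mp ((Submodule.fg_iff_addSubgroup_fg
        (AddSubgroup.toIntSubmodule (Subgroup.toAddSubgroup τ.range))).mp
        (IsNoetherian.noetherian _)))
  have := (Group.fg_iff_subgroup_fg _).mpr hr
  exact Group.fg_of_surjective (f := (MonoidHom.ofInjective hτ).symm.toMonoidHom)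
    (MonoidHom.ofInjective hτ).symm.surjective

/-- A virtually finitely generated free abelian group does not virtually have many
quasimorphisms. -/
theorem not_virtuallyManyQuasimorphisms_of_injective {G ι : Type*} [Group G] [Finite ι]
    (A : Subgroup G) [A.FiniteIndex] (τ : A →* Multiplicative (ι → ℤ))
    (hτ : Function.Injective τ) : ¬ VirtuallyManyQuasimorphisms G := by
  rintro ⟨H, hH, hmany⟩
  refine hmany ?_
  let Q : Subgroup H := A.subgroupOf H
  have hcomm : ∀ x y : Q, Commute (x : H) (y : H) := fun x y => by
    have hxy : (⟨x.1.1, x.2⟩ : A) * ⟨y.1.1, y.2⟩ = ⟨y.1.1, y.2⟩ * ⟨x.1.1, x.2⟩ :=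
      hτ (by rw [map_mul, map_mul, mul_comm])
    exact Subtype.ext (congrArg (fun a : A => (a : G)) hxy)
  let τQ : Q →* Multiplicative (ι → ℤ) :=
    τ.comp ((H.subtype.comp Q.subtype).codRestrict A fun x => x.2)
  have hτQ : Function.Injective τQ := fun x y hxy => by
    have := hτ hxy
    exact Subtype.ext (Subtype.ext (congrArg (fun a : A => (a : G)) this))
  obtain ⟨-, S, -, hS⟩ := Group.fg_iff'.mp (fg_of_injective_lattice hτQ)
  let L : homogeneousQuasimorphisms H →ₗ[ℝ] (S → ℝ) :=
    { toFun := fun f x => f.1 x.1.1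
      map_add' := fun _ _ => rfl
      map_smul' := fun _ _ => rfl }
  have hL : Function.Injective L := by
    rw [injective_iff_map_eq_zero]
    rintro ⟨f, hq, hh⟩ hf
    have hQ : ∀ x : Q, f x = 0 := by
      intro x
      have hx : x ∈ Subgroup.closure (S : Set Q) := hS ▸ Subgroup.mem_top x
      induction hx using Subgroup.closure_induction with
      | mem y hy => exact congrFun hf ⟨y, hy⟩
      | one => simpa using hh 1 0
      | mul y z _ _ hy hz =>
        rw [Subgroup.coe_mul, hq.map_mul_of_commute hh (hcomm y z), hy, hz, add_zero]
      | inv y _ hy =>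
        have := hh (y : H) (-1)
        rw [zpow_neg_one, hy, mul_zero] at this
        simpa using this
    ext g
    obtain ⟨n, hn, hgn⟩ : ∃ n : ℕ, 0 < n ∧ g ^ n ∈ Q := by
      obtain ⟨n, hn, -, h⟩ := Subgroup.exists_pow_mem_of_index_ne_zero
        (Subgroup.FiniteIndex.index_ne_zero (H := Q)) g
      exact ⟨n, hn, h⟩
    have h1 := hQ ⟨g ^ n, hgn⟩
    have h2 := hh g n
    rw [zpow_natCast, h1] at h2
    have hn' : ((n : ℤ) : ℝ) ≠ 0 := by exact_mod_cast hn.ne'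
    exact (mul_eq_zero.mp h2.symm).resolve_left hn'
  have hfin : Module.Finite ℝ (homogeneousQuasimorphisms H) := Module.Finite.of_injective L hL
  obtain ⟨t, ht⟩ := Module.Finite.iff_fg.mp hfin
  exact ⟨t, fun f hq hh => ht ▸ (⟨hq, hh⟩ : f ∈ homogeneousQuasimorphisms H)⟩

namespace RACG

open SignedTranslation

variable {V : Type*} {Γ : SimpleGraph V}

/-- The retraction onto the subgroup generated by the vertices of a given colour. -/
noncomputable def blockRetraction (Γ : SimpleGraph V) {ι : Type*} [DecidableEq ι] (c : V → ι)
    (i : ι) : RACG Γ →* RACG Γ :=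
  lift (fun v => if c v = i then gen Γ v else 1)
    (fun v => by split_ifs <;> simp)
    (fun u v huv => by
      split_ifs
      exacts [commute_gen huv, Commute.one_right _, Commute.one_left _, Commute.one_left _])

@[simp]
theorem blockRetraction_gen {ι : Type*} [DecidableEq ι] (c : V → ι) (i : ι) (v : V) :
    blockRetraction Γ c i (gen Γ v) = if c v = i then gen Γ v else 1 :=
  lift_gen _ _ _ v

theorem eq_one_of_blockRetraction {ι : Type*} [DecidableEq ι] [Finite ι] {c : V → ι}
    (hc : ∀ x y, c x ≠ c y → Γ.Adj x y) {g : RACG Γ} (hg : ∀ i, blockRetraction Γ c i g = 1) :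
    g = 1 := by
  have := Fintype.ofFinite ι
  have hcomm : ∀ i j, i ≠ j → ∀ x y, Commute (blockRetraction Γ c i x) (blockRetraction Γ c j y) := by
    intro i j hij x y
    have hx : x ∈ Subgroup.closure (Set.range (gen Γ)) := closure_range_gen ▸ Subgroup.mem_top x
    induction hx using Subgroup.closure_induction with
    | one => rw [map_one]; exact Commute.one_left _
    | mul _ _ _ _ h₁ h₂ => rw [map_mul]; exact h₁.mul_left h₂
    | inv _ _ h => rw [map_inv]; exact h.inv_left
    | mem _ hu =>
      obtain ⟨u, rfl⟩ := hu
      have hy : y ∈ Subgroup.closure (Set.range (gen Γ)) := closure_range_gen ▸ Subgroup.mem_top y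
      induction hy using Subgroup.closure_induction with
      | one => rw [map_one]; exact Commute.one_right _
      | mul _ _ _ _ h₁ h₂ => rw [map_mul]; exact h₁.mul_right h₂
      | inv _ _ h => rw [map_inv]; exact h.inv_right
      | mem _ hv =>
        obtain ⟨v, rfl⟩ := hv
        rw [blockRetraction_gen, blockRetraction_gen]
        split_ifs with h₁ h₂
        · exact commute_gen (hc u v (by rw [h₁, h₂]; exact hij))
        · exact Commute.one_right _
        · exact Commute.one_left _
        · exact Commute.one_left _
  let F : (∀ i, (blockRetraction Γ c i).range) →* RACG Γ :=
    MonoidHom.noncommPiCoprod (fun i => (blockRetraction Γ c i).range.subtype) (by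
      rintro i j hij ⟨_, x, rfl⟩ ⟨_, y, rfl⟩
      exact hcomm i j hij x y)
  have hF : F.comp (MonoidHom.pi fun i => (blockRetraction Γ c i).rangeRestrict) =
      MonoidHom.id _ := hom_ext fun v => by
    have hv : MonoidHom.pi (fun i => (blockRetraction Γ c i).rangeRestrict) (gen Γ v) =
        Pi.mulSingle (c v) ((blockRetraction Γ c (c v)).rangeRestrict (gen Γ v)) := by
      ext i
      by_cases hi : i = c v
      · subst hi
        simp
      · simp [Ne.symm hi]
    rw [MonoidHom.comp_apply, hv]
    refine (MonoidHom.noncommPiCoprod_mulSingle _ _ _).trans ?_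
    simp
  rw [← MonoidHom.id_apply (RACG Γ) g, ← hF, MonoidHom.comp_apply]
  have : MonoidHom.pi (fun i => (blockRetraction Γ c i).rangeRestrict) g = 1 := by
    ext i
    simp [hg]
  rw [this, map_one]

/-- The homomorphism from the infinite dihedral group determined by two involutions. -/
def dihedralLift {G : Type*} [Group G] (a b : G) (ha : a * a = 1) (hb : b * b = 1) :
    SignedTranslation Unit →* G where
  toFun x := (a * b) ^ x.vec () * if x.sgn = 1 then 1 else b
  map_one' := by simp
  map_mul' x y := by
    obtain ⟨z, ε⟩ := x
    obtain ⟨w, δ⟩ := y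
    have hba : SemiconjBy b (a * b) (a * b)⁻¹ := by
      have ha' : a⁻¹ = a := inv_eq_of_mul_eq_one_left ha
      have hb' : b⁻¹ = b := inv_eq_of_mul_eq_one_left hb
      rw [SemiconjBy, mul_inv_rev, ha', hb', mul_assoc]
    have hw := hba.zpow_right (w ())
    rw [inv_zpow, ← zpow_neg] at hw
    rcases Int.units_eq_one_or ε with rfl | rfl <;> rcases Int.units_eq_one_or δ with rfl | rfl
    · simp [zpow_add]
    · simp [zpow_add, mul_assoc]
    · simp [zpow_add, mul_assoc, hw.eq]
    · have hw' : b * ((a * b) ^ w () * b) = (a * b) ^ (-w ()) := by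
        rw [← mul_assoc, hw.eq, mul_assoc, hb, mul_one]
      have hne : (-1 : ℤˣ) ≠ 1 := by decide
      simp [zpow_add, mul_assoc, hne] at hw' ⊢
      rw [hw']

/-- The enumeration of a pair of vertices with the second one as base point. -/
def pairEmb (p : V × V) : Option Unit → V := fun k => k.elim p.2 fun _ => p.1

variable (Γ) in
/-- The pairs of distinct non-adjacent vertices. -/
abbrev NonEdge := {p : V × V // p.1 ≠ p.2 ∧ ¬ Γ.Adj p.1 p.2}

theorem pairEmb_injective (p : NonEdge Γ) : Function.Injective (pairEmb p.1) := by
  rintro (_ | _) (_ | _) h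
  · rfl
  · exact absurd h.symm p.2.1
  · exact absurd h p.2.1
  · rfl

theorem not_adj_pairEmb (p : NonEdge Γ) (k l : Option Unit) :
    ¬ Γ.Adj (pairEmb p.1 k) (pairEmb p.1 l) := by
  rcases k with _ | _ <;> rcases l with _ | _
  · exact Γ.irrefl
  · exact fun h => p.2.2 h.symm
  · exact p.2.2
  · exact Γ.irrefl

/-- The projection to the infinite dihedral group attached to a pair of non-adjacent vertices. -/
noncomputable def dihedralProj (p : NonEdge Γ) : RACG Γ →* SignedTranslation Unit :=
  latticeProj (pairEmb p.1) (pairEmb_injective p) (not_adj_pairEmb p)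

theorem eq_one_of_dihedralProj [Finite V] (h : ¬ HasVertexWithTwoNonNeighbors Γ) {g : RACG Γ}
    (hχ : ∀ χ : RACG Γ →* ℤˣ, χ g = 1) (hp : ∀ p : NonEdge Γ, dihedralProj p g = 1) :
    g = 1 := by
  classical
  let r : Setoid V :=
    { r := fun x y => ¬ Γ.Adj x y
      iseqv :=
        { refl := fun x => Γ.irrefl
          symm := fun h h' => h h'.symm
          trans := by
            intro x y z hxy hyz hxz
            refine h ⟨y, x, z, hxz.ne, ?_, ?_, fun h' => hxy h'.symm, hyz⟩
            · rintro rfl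
              exact hyz hxz
            · rintro rfl
              exact hxy hxz } }
  have hr : ∀ x y : V, (Quotient.mk r x = Quotient.mk r y) ↔ ¬ Γ.Adj x y := fun x y => Quotient.eq
  refine eq_one_of_blockRetraction (c := Quotient.mk r)
    (fun x y hxy => by rwa [Ne, hr, not_not] at hxy) fun i => ?_
  induction i using Quotient.ind with
  | _ v =>
    by_cases hv : ∃ u, u ≠ v ∧ ¬ Γ.Adj u v
    · obtain ⟨u, huv, hadj⟩ := hv
      let p : NonEdge Γ := ⟨(u, v), huv, hadj⟩
      have hq : blockRetraction Γ (Quotient.mk r) (Quotient.mk r v) =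
          (dihedralLift (gen Γ u) (gen Γ v) (gen_mul_gen u) (gen_mul_gen v)).comp
            (dihedralProj p) := hom_ext fun x => by
        have hsv : pairEmb p.1 none = v := rfl
        have hsu : pairEmb p.1 (some ()) = u := rfl
        rw [blockRetraction_gen, MonoidHom.comp_apply, dihedralProj]
        simp only [hr]
        by_cases hxv : x = v
        · subst hxv
          have h1 := latticeProj_gen_none (s := pairEmb p.1) (hs := pairEmb_injective p)
            (hind := not_adj_pairEmb p)
          rw [hsv] at h1
          rw [h1]
          simp [dihedralLift]
        by_cases hxu : x = u
        · subst hxu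
          have h1 := latticeProj_gen_some (s := pairEmb p.1) (hs := pairEmb_injective p)
            (hind := not_adj_pairEmb p) ()
          rw [hsu] at h1
          rw [h1]
          simp [dihedralLift, hadj, mul_assoc]
        have hadj' : Γ.Adj x v := by
          by_contra hc
          exact h ⟨v, u, x, Ne.symm hxu, huv, hxv, fun h' => hadj h'.symm, fun h' => hc h'.symm⟩
        rw [latticeProj_gen_of_notMem, map_one, if_neg (not_not.mpr hadj')]
        rintro ⟨_ | _, h'⟩
        · exact hxv h'.symm
        · exact hxu h'.symm
      rw [hq, MonoidHom.comp_apply, hp, map_one]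
    · push Not at hv
      let χ : RACG Γ →* ℤˣ := lift (fun x => if x = v then -1 else 1)
        (fun x => by split_ifs <;> simp) (fun _ _ _ => Commute.all _ _)
      let e : ℤˣ →* RACG Γ := (dihedralLift (gen Γ v) (gen Γ v) (gen_mul_gen v) (gen_mul_gen v)).comp
        ⟨⟨fun x => ⟨0, x⟩, rfl⟩, fun x y => by ext <;> simp⟩
      have hq : blockRetraction Γ (Quotient.mk r) (Quotient.mk r v) = e.comp χ :=
        hom_ext fun x => by
        rw [blockRetraction_gen, MonoidHom.comp_apply, lift_gen]
        simp only [hr]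
        by_cases hxv : x = v
        · subst hxv
          simp [e, dihedralLift]
        · simp [hxv, hv x hxv]
      rw [hq, MonoidHom.comp_apply, hχ, map_one]

end RACG

/-- The kernel of a homomorphism defined on a subgroup, as a subgroup of the ambient group. -/
def Subgroup.kerOn {G K : Type*} [Group G] [Group K] (H : Subgroup G) (f : H →* K) : Subgroup G :=
  f.ker.map H.subtype

theorem Subgroup.mem_kerOn {G K : Type*} [Group G] [Group K] {H : Subgroup G} {f : H →* K}
    {x : G} : x ∈ H.kerOn f ↔ ∃ h : x ∈ H, f ⟨x, h⟩ = 1 := by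
  simp [Subgroup.kerOn, Subgroup.mem_map, MonoidHom.mem_ker]

instance {G K : Type*} [Group G] [Group K] [Finite K] (H : Subgroup G) [H.FiniteIndex]
    (f : H →* K) : (H.kerOn f).FiniteIndex := by
  refine ⟨?_⟩
  rw [Subgroup.kerOn, Subgroup.index_map_subtype]
  exact mul_ne_zero Subgroup.FiniteIndex.index_ne_zero Subgroup.FiniteIndex.index_ne_zero

namespace RACG

open SignedTranslation

variable {V : Type*} {Γ : SimpleGraph V}

theorem not_virtuallyManyQuasimorphisms [Finite V] (h : ¬ HasVertexWithTwoNonNeighbors Γ) :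
    ¬ VirtuallyManyQuasimorphisms (MulAut (RACG Γ)) := by
  let m (p : NonEdge Γ) : torelli Γ →* Matrix Unit Unit ℤ :=
    latticeHom (pairEmb p.1) (pairEmb_injective p) (not_adj_pairEmb p)
  let D : torelli Γ →* (NonEdge Γ → ℤˣ) :=
    MonoidHom.pi fun p => (Matrix.detMonoidHom.comp (m p)).toHomUnits
  let A : Subgroup (MulAut (RACG Γ)) := (torelli Γ).kerOn D
  have hA : ∀ x ∈ A, ∃ hx : x ∈ torelli Γ, ∀ p, m p ⟨x, hx⟩ = 1 := by
    intro x hx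
    obtain ⟨hx, h1⟩ := Subgroup.mem_kerOn.mp hx
    refine ⟨hx, fun p => ?_⟩
    have h2 := congrArg (fun u : ℤˣ => (u : ℤ)) (congrFun h1 p)
    ext i j
    simpa [D, Matrix.det_unique] using h2
  have hsgn : ∀ x ∈ A, ∀ p g, (dihedralProj p (x g)).sgn = (dihedralProj p g).sgn :=
    fun x hx p g => sgn_latticeProj_of_mem_torelli (hA x hx).1 g
  have hvec : ∀ x ∈ A, ∀ p g, (dihedralProj p (x g)).vec = (dihedralProj p g).vec +
      if (dihedralProj p g).sgn = 1 then 0 else (dihedralProj p (x (gen Γ p.1.2))).vec := by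
    intro x hx p g
    obtain ⟨hx, h1⟩ := hA x hx
    have h2 := latticeProj_apply_of_mem_torelli (s := pairEmb p.1) (hs := pairEmb_injective p)
      (hind := not_adj_pairEmb p) hx g
    have h3 : latticeMatrix (pairEmb p.1) (pairEmb_injective p) (not_adj_pairEmb p) x = 1 := h1 p
    rw [h3] at h2
    rw [dihedralProj, h2]
    simp [endOfMatrix, pairEmb]
  have hgen : ∀ p : NonEdge Γ, dihedralProj p (gen Γ p.1.2) = ⟨0, -1⟩ := fun p =>
    latticeProj_gen_none (s := pairEmb p.1)
  have hne : (-1 : ℤˣ) ≠ 1 := by decide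
  let τ : A →* Multiplicative (NonEdge Γ → ℤ) :=
    { toFun := fun x => Multiplicative.ofAdd fun p =>
        (dihedralProj p (x.1 (gen Γ p.1.2))).vec ()
      map_one' := by
        simp only [OneMemClass.coe_one, MulAut.one_apply, hgen]
        rfl
      map_mul' := fun x y => by
        rw [← ofAdd_add]
        refine congrArg _ (funext fun p => ?_)
        rw [Subgroup.coe_mul, MulAut.mul_apply, hvec x.1 x.2, hsgn y.1 y.2, hgen, if_neg hne,
          add_comm]
        rfl }
  refine not_virtuallyManyQuasimorphisms_of_injective A τ ?_
  rw [injective_iff_map_eq_one]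
  intro x hx
  have hx0 : ∀ p : NonEdge Γ, (dihedralProj p (x.1 (gen Γ p.1.2))).vec = 0 := fun p =>
    funext fun _ => congrFun (congrArg Multiplicative.toAdd hx) p
  refine Subtype.ext (MulEquiv.ext fun g => mul_inv_eq_one.mp ?_)
  change x.1 g * g⁻¹ = 1
  refine eq_one_of_dihedralProj h (fun χ => ?_) fun p => ?_
  · rw [map_mul, map_inv, (hA x.1 x.2).1 χ g, mul_inv_cancel]
  · rw [map_mul, map_inv, mul_inv_eq_one]
    refine SignedTranslation.ext ?_ (hsgn x.1 x.2 p g)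
    rw [hvec x.1 x.2, hx0, ite_self, add_zero]

end RACG

namespace FreeGroup

/-- The action of the Klein four-group on the letters of the free group of rank two by swapping and
by inverting the generators. -/
def letterPerm (p : ℤˣ × ℤˣ) (a : Bool × Bool) : Bool × Bool :=
  (if p.1 = 1 then a.1 else !a.1, if p.2 = 1 then a.2 else !a.2)

theorem letterPerm_one : letterPerm 1 = id := by
  funext a
  simp [letterPerm]

theorem letterPerm_mul (p q : ℤˣ × ℤˣ) : letterPerm (p * q) = letterPerm p ∘ letterPerm q := by
  revert p q
  have h : ∀ (p q : ℤˣ × ℤˣ) (a : Bool × Bool),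
    letterPerm (p * q) a = letterPerm p (letterPerm q a) := by decide
  exact fun p q => funext (h p q)

/-- The endomorphism of the free group of rank two that permutes the letters. -/
def wordEnd (p : ℤˣ × ℤˣ) : FreeGroup Bool →* FreeGroup Bool :=
  lift fun k => mk [letterPerm p (k, true)]

theorem wordEnd_mk (p : ℤˣ × ℤˣ) (L : List (Bool × Bool)) :
    wordEnd p (mk L) = mk (L.map (letterPerm p)) := by
  induction L with
  | nil => exact _root_.map_one _
  | cons a L ih =>
    have h : mk (a :: L) = mk [a] * mk L := by simp
    rw [h, _root_.map_mul, ih, List.map_cons, ← List.singleton_append (l := L.map _), ← mul_mk]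
    congr 1
    obtain ⟨k, _ | _⟩ := a <;> simp [wordEnd, letterPerm, inv_mk, invRev]

/-- The action of the Klein four-group on the free group of rank two by swapping and by inverting
the generators. -/
def wordAut : ℤˣ × ℤˣ →* MulAut (FreeGroup Bool) where
  toFun p :=
    { wordEnd p with
      invFun := wordEnd p
      left_inv := fun g => by
        change wordEnd p (wordEnd p g) = g
        rw [← mk_toWord (x := g), wordEnd_mk, wordEnd_mk, List.map_map, ← letterPerm_mul]
        have : p * p = 1 := Prod.ext (Int.units_mul_self _) (Int.units_mul_self _)
        rw [this, letterPerm_one, List.map_id]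
      right_inv := fun g => by
        change wordEnd p (wordEnd p g) = g
        rw [← mk_toWord (x := g), wordEnd_mk, wordEnd_mk, List.map_map, ← letterPerm_mul]
        have : p * p = 1 := Prod.ext (Int.units_mul_self _) (Int.units_mul_self _)
        rw [this, letterPerm_one, List.map_id] }
  map_one' := MulEquiv.ext fun g => by
    change wordEnd 1 g = g
    rw [← mk_toWord (x := g), wordEnd_mk, letterPerm_one, List.map_id]
  map_mul' p q := MulEquiv.ext fun g => by
    change wordEnd (p * q) g = wordEnd p (wordEnd q g)
    rw [← mk_toWord (x := g), wordEnd_mk, wordEnd_mk, wordEnd_mk, List.map_map, ← letterPerm_mul]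

theorem wordAut_mk (p : ℤˣ × ℤˣ) (L : List (Bool × Bool)) :
    wordAut p (mk L) = mk (L.map (letterPerm p)) :=
  wordEnd_mk p L

theorem wordAut_of (p : ℤˣ × ℤˣ) (k : Bool) : wordAut p (of k) = mk [letterPerm p (k, true)] :=
  wordEnd_mk p _

theorem toWord_wordAut (p : ℤˣ × ℤˣ) (g : FreeGroup Bool) :
    (wordAut p g).toWord = g.toWord.map (letterPerm p) := by
  have h : ∀ a b : Bool × Bool, (a.1 = b.1 → a.2 = b.2) →
      ((letterPerm p a).1 = (letterPerm p b).1 → (letterPerm p a).2 = (letterPerm p b).2) := by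
    revert p
    decide
  conv_lhs => rw [← mk_toWord (x := g), wordAut_mk]
  refine IsReduced.reduce_eq ?_
  rw [IsReduced, List.isChain_map]
  exact isReduced_toWord.imp fun a b => h a b

theorem eq_one_of_swap_eq_self {g : FreeGroup Bool} (h : wordAut (-1, 1) g = g) : g = 1 := by
  have h1 := toWord_wordAut (-1, 1) g
  rw [h] at h1
  rw [← toWord_eq_nil_iff]
  rcases hL : g.toWord with _ | ⟨a, L⟩
  · rfl
  · rw [hL, List.map_cons] at h1
    have h2 : ∀ a, a ≠ letterPerm (-1, 1) a := by decide
    exact absurd (List.cons.inj h1).1 (h2 a)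

theorem exists_eq_mul_inv_of_map_swap {L : List (Bool × Bool)}
    (hL : L.map (letterPerm (-1, 1)) = invRev L) :
    ∃ h : FreeGroup Bool, mk L = h * (wordAut (-1, 1) h)⁻¹ := by
  induction L using List.bidirectionalRec with
  | nil => exact ⟨1, by simp [← one_eq_mk]⟩
  | singleton a =>
    exfalso
    have h2 := (List.cons.inj hL).1
    revert h2 a
    decide
  | cons_append a L b ih =>
    have h1 : invRev (a :: (L ++ [b])) = (b.1, !b.2) :: (invRev L ++ [(a.1, !a.2)]) := by
      simp [invRev]
    rw [h1, List.map_cons, List.map_append, List.cons.injEq] at hL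
    obtain ⟨hab, hL⟩ := hL
    have hL' := List.append_inj_left' hL rfl
    obtain ⟨h, hh⟩ := ih hL'
    refine ⟨mk [a] * h, ?_⟩
    have h2 : mk (a :: (L ++ [b])) = mk [a] * mk L * mk [b] := by simp
    rw [h2, hh, _root_.map_mul, wordAut_mk, mul_inv_rev, List.map_singleton, hab, inv_mk]
    simp [invRev, mul_assoc]

theorem exists_eq_mul_inv_of_swap_eq_inv {g : FreeGroup Bool} (h : wordAut (-1, 1) g = g⁻¹) :
    ∃ h : FreeGroup Bool, g = h * (wordAut (-1, 1) h)⁻¹ := by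
  have h1 := toWord_wordAut (-1, 1) g
  rw [h, toWord_inv] at h1
  obtain ⟨h, hh⟩ := exists_eq_mul_inv_of_map_swap h1.symm
  exact ⟨h, by rw [← hh, mk_toWord]⟩

/-- The element of the Klein four-group that maps a fixed letter to a given one. -/
def letterElt (a : Bool × Bool) : ℤˣ × ℤˣ := (if a.1 then 1 else -1, if a.2 then 1 else -1)

theorem lift_wordAut_mk_singleton {q : FreeGroup Bool} (hq : wordAut (1, -1) q = q⁻¹)
    (a : Bool × Bool) :
    lift (fun k => wordAut (letterElt (k, true)) q) (mk [a]) = wordAut (letterElt a) q := by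
  obtain ⟨k, _ | _⟩ := a
  · have h2 : letterElt (k, false) = letterElt (k, true) * (1, -1) := by
      cases k <;> decide
    rw [h2, _root_.map_mul, MulAut.mul_apply, hq, _root_.map_inv]
    simp
  · simp

theorem exists_wordAut_eq_of_surjective {q : FreeGroup Bool} (hq : wordAut (1, -1) q = q⁻¹)
    (hs : Function.Surjective (lift fun k => wordAut (letterElt (k, true)) q)) :
    ∃ p, q = wordAut p (of true) := by
  set L := q.toWord with hL
  have hpal : L.reverse = L := by
    have h1 := toWord_wordAut (1, -1) q
    rw [hq, toWord_inv, ← hL] at h1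
    have h2 : (invRev L) = (L.reverse).map (letterPerm (1, -1)) := by
      simp [invRev, letterPerm]
    rw [h2] at h1
    refine List.map_injective_iff.mpr (fun a b => ?_) h1
    revert a b
    decide
  have hne : L ≠ [] := by
    intro h0
    rw [toWord_eq_nil_iff] at h0
    obtain ⟨r, hr⟩ := hs (of true)
    have : lift (fun k => wordAut (letterElt (k, true)) q) = 1 := by
      ext k
      simp [h0]
    rw [this, MonoidHom.one_apply] at hr
    exact one_ne_of _ hr
  let Q : Bool × Bool → List (Bool × Bool) := fun a => L.map (letterPerm (letterElt a))
  have hQ : ∀ r : List (Bool × Bool),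
      lift (fun k => wordAut (letterElt (k, true)) q) (mk r) = mk (r.map Q).flatten := by
    intro r
    induction r with
    | nil => exact _root_.map_one _
    | cons a r ih =>
      have h : mk (a :: r) = mk [a] * mk r := by simp
      rw [h, _root_.map_mul, ih, List.map_cons, List.flatten_cons, ← mul_mk]
      congr 1
      have h1 : mk (Q a) = wordAut (letterElt a) q := by
        rw [← mk_toWord (x := q), wordAut_mk]
      rw [h1, lift_wordAut_mk_singleton hq]
  have hred : ∀ r : List (Bool × Bool), IsReduced r → IsReduced (r.map Q).flatten := by
    intro r hr
    rw [IsReduced, List.isChain_flatten (by simp [Q, hne])]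
    refine ⟨?_, ?_⟩
    · intro l hl
      obtain ⟨a, -, rfl⟩ := List.mem_map.mp hl
      have := isReduced_toWord (x := wordAut (letterElt a) q)
      rwa [toWord_wordAut] at this
    · rw [List.isChain_map]
      refine hr.imp fun a b hab x hx y hy => ?_
      rw [List.getLast?_map, ← List.head?_reverse, hpal] at hx
      rw [List.head?_map] at hy
      obtain ⟨c, hc, rfl⟩ := Option.mem_map.mp hx
      obtain ⟨d, hd, rfl⟩ := Option.mem_map.mp hy
      obtain rfl := Option.mem_unique hc hd
      have key : ∀ a b c : Bool × Bool, (a.1 = b.1 → a.2 = b.2) →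
          ((letterPerm (letterElt a) c).1 = (letterPerm (letterElt b) c).1 →
            (letterPerm (letterElt a) c).2 = (letterPerm (letterElt b) c).2) := by
        decide
      exact key a b c hab
  obtain ⟨r, hr⟩ := hs (of true)
  rw [← mk_toWord (x := r), hQ] at hr
  have h1 := congrArg toWord hr
  rw [toWord_of, toWord_mk, (hred _ isReduced_toWord).reduce_eq] at h1
  have h2 : L.length = 1 := by
    have h3 := congrArg List.length h1
    have h4 : ∀ r : List (Bool × Bool), (r.map Q).flatten.length = r.length * L.length := by
      intro r
      induction r with
      | nil => simp
      | cons a r ih => 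
        rw [List.map_cons, List.flatten_cons, List.length_append, ih, List.length_cons]
        simp only [Q, List.length_map]
        ring
    rw [h4] at h3
    exact Nat.eq_one_of_mul_eq_one_left h3
  obtain ⟨a, ha⟩ := List.length_eq_one_iff.mp h2
  refine ⟨letterElt a, ?_⟩
  rw [wordAut_of, ← mk_toWord (x := q), ← hL, ha]
  have : ∀ a, a = letterPerm (letterElt a) (true, true) := by decide
  rw [← this]

end FreeGroup

/-- The extension of the free group of rank two by the Klein four-group that swaps and inverts the
generators. -/
abbrev FreeKlein : Type := FreeGroup Bool ⋊[FreeGroup.wordAut] (ℤˣ × ℤˣ)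

namespace FreeKlein

open FreeGroup

theorem mul_swap (x : FreeKlein) (p : ℤˣ × ℤˣ) :
    x * ⟨1, p⟩ = ⟨x.left, x.right * p⟩ := by
  ext <;> simp

theorem swap_mul (x : FreeKlein) (p : ℤˣ × ℤˣ) :
    ⟨1, p⟩ * x = ⟨wordAut p x.left, p * x.right⟩ := by
  ext <;> simp

theorem eq_one_of_forall_commute {d : FreeKlein} (h : ∀ x, Commute d x) : d = 1 := by
  have h1 : d.left = 1 := by
    have := (h ⟨1, (-1, 1)⟩).eq
    rw [mul_swap, swap_mul] at this
    exact eq_one_of_swap_eq_self (SemidirectProduct.ext_iff.mp this).1.symm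
  have h2 := (SemidirectProduct.ext_iff.mp (h (SemidirectProduct.inl (of true))).eq).1
  rw [SemidirectProduct.mul_left, SemidirectProduct.mul_left, h1, one_mul,
    SemidirectProduct.left_inl, SemidirectProduct.right_inl, _root_.map_one, mul_one,
    wordAut_of] at h2
  have h3 := congrArg toWord h2
  rw [toWord_of, toWord_mk, reduce_singleton] at h3
  have key : ∀ p, letterPerm p (true, true) = (true, true) → p = 1 := by decide
  exact SemidirectProduct.ext h1 (key _ (List.cons.inj h3).1)

theorem conj_injective : Function.Injective (MulAut.conj : FreeKlein →* MulAut FreeKlein) := by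
  rw [injective_iff_map_eq_one]
  intro d hd
  refine eq_one_of_forall_commute fun x => ?_
  have := DFunLike.congr_fun hd x
  rw [MulAut.conj_apply, MulAut.one_apply] at this
  exact mul_inv_eq_iff_eq_mul.mp this

theorem eq_one_of_mul_self {d : FreeKlein} (hr : d.right = 1) (h : d * d = 1) : d = 1 := by
  have h1 := (SemidirectProduct.ext_iff.mp h).1
  rw [SemidirectProduct.mul_left, hr, _root_.map_one, MulAut.one_apply, SemidirectProduct.one_left,
    ← sq] at h1
  exact SemidirectProduct.ext ((pow_eq_one_iff_left two_ne_zero).mp h1) hr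

end FreeKlein

namespace RACG

open FreeGroup FreeKlein

variable {V : Type*} {Γ : SimpleGraph V}

/-- The projection to an extension of a free group that is attached to a vertex and an edge that
are not joined. -/
noncomputable def kleinProj (s : Fin 3 → V) (hs : Function.Injective s)
    (hind : ∀ k, ¬ Γ.Adj (s 0) (s k)) : RACG Γ →* FreeKlein :=
  extendLift s hs ![⟨of true, (1, -1)⟩, ⟨1, (-1, 1)⟩, ⟨1, (1, -1)⟩]
    (fun k => by
      fin_cases k
      · refine SemidirectProduct.ext ?_ (by decide)
        change of true * wordAut (1, -1) (of true) = 1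
        rw [wordAut_of]
        decide
      · ext <;> simp
      · ext <;> simp)
    (fun k l h => by
      rcases eq_or_ne k 0 with rfl | hk
      · exact absurd h (hind l)
      rcases eq_or_ne l 0 with rfl | hl
      · exact absurd h.symm (hind k)
      fin_cases k <;> fin_cases l
      · exact absurd rfl hk
      · exact absurd rfl hk
      · exact absurd rfl hk
      · exact absurd rfl hl
      · exact Commute.refl _
      · rw [commute_iff_eq]
        ext <;> simp
      · exact absurd rfl hl
      · rw [commute_iff_eq]
        ext <;> simp
      · exact Commute.refl _)

variable {s : Fin 3 → V} {hs : Function.Injective s} {hind : ∀ k, ¬ Γ.Adj (s 0) (s k)}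

theorem kleinProj_gen_zero : kleinProj s hs hind (gen Γ (s 0)) = ⟨of true, (1, -1)⟩ :=
  extendLift_gen _

theorem kleinProj_gen_one : kleinProj s hs hind (gen Γ (s 1)) = ⟨1, (-1, 1)⟩ :=
  extendLift_gen _

theorem kleinProj_gen_two : kleinProj s hs hind (gen Γ (s 2)) = ⟨1, (1, -1)⟩ :=
  extendLift_gen _

theorem kleinProj_surjective : Function.Surjective (kleinProj s hs hind) := by
  rw [← MonoidHom.range_eq_top]
  have h0 : (⟨of true, (1, -1)⟩ : FreeKlein) ∈ (kleinProj s hs hind).range :=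
    ⟨_, kleinProj_gen_zero⟩
  have h1 : (⟨1, (-1, 1)⟩ : FreeKlein) ∈ (kleinProj s hs hind).range := ⟨_, kleinProj_gen_one⟩
  have h2 : (⟨1, (1, -1)⟩ : FreeKlein) ∈ (kleinProj s hs hind).range := ⟨_, kleinProj_gen_two⟩
  have ht : (SemidirectProduct.inl (of true) : FreeKlein) ∈ (kleinProj s hs hind).range := by
    convert mul_mem h0 h2 using 1
    ext <;> simp
  have hf : (SemidirectProduct.inl (of false) : FreeKlein) ∈ (kleinProj s hs hind).range := by
    convert mul_mem (mul_mem h1 ht) h1 using 1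
    refine SemidirectProduct.ext ?_ rfl
    simp only [SemidirectProduct.mul_left, SemidirectProduct.left_inl, one_mul,
      _root_.map_one, mul_one]
    rw [wordAut_of]
    rfl
  have hl : ∀ g, (SemidirectProduct.inl g : FreeKlein) ∈ (kleinProj s hs hind).range := by
    intro g
    have hg : g ∈ Subgroup.closure (Set.range of) := closure_range_of (α := Bool) ▸ Subgroup.mem_top g
    induction hg using Subgroup.closure_induction with
    | one => rw [_root_.map_one]; exact one_mem _
    | mul _ _ _ _ hx hy => rw [_root_.map_mul]; exact mul_mem hx hy
    | inv _ _ hx => rw [_root_.map_inv]; exact inv_mem hx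
    | mem _ hk =>
      obtain ⟨_ | _, rfl⟩ := hk
      exacts [hf, ht]
  rw [eq_top_iff]
  rintro ⟨g, ε, δ⟩ -
  rw [SemidirectProduct.mk_eq_inl_mul_inr]
  refine mul_mem (hl g) ?_
  rcases Int.units_eq_one_or ε with rfl | rfl <;> rcases Int.units_eq_one_or δ with rfl | rfl
  · exact one_mem _
  · exact h2
  · exact h1
  · convert mul_mem h1 h2 using 1
    ext <;> simp

theorem exists_eq_conj_comp_kleinProj_of_gen {f : RACG Γ →* FreeKlein}
    (hf : Function.Surjective f) (hr : ∀ g, (f g).right = (kleinProj s hs hind g).right)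
    (h1 : f (gen Γ (s 1)) = ⟨1, (-1, 1)⟩) (h2 : f (gen Γ (s 2)) = ⟨1, (1, -1)⟩) :
    ∃ d, f = (MulAut.conj d).toMonoidHom.comp (kleinProj s hs hind) := by
  set q := (f (gen Γ (s 0))).left with hq
  have h0 : f (gen Γ (s 0)) = ⟨q, (1, -1)⟩ :=
    SemidirectProduct.ext rfl (by rw [hr, kleinProj_gen_zero])
  have hqq : wordAut (1, -1) q = q⁻¹ := by
    have h3 := congrArg f (gen_mul_gen (Γ := Γ) (s 0))
    rw [_root_.map_mul, _root_.map_one, h0] at h3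
    exact (inv_eq_of_mul_eq_one_right (SemidirectProduct.ext_iff.mp h3).1).symm
  have hout : ∀ v, (¬ ∃ k, s k = v) → f (gen Γ v) = 1 := by
    intro v hv
    refine eq_one_of_mul_self ?_ ?_
    · rw [hr, kleinProj, extendLift_gen_of_notMem hv, SemidirectProduct.one_right]
    · rw [← _root_.map_mul, gen_mul_gen, _root_.map_one]
  have hext : ∀ f' : RACG Γ →* FreeKlein, f' (gen Γ (s 0)) = ⟨q, (1, -1)⟩ →
      f' (gen Γ (s 1)) = ⟨1, (-1, 1)⟩ → f' (gen Γ (s 2)) = ⟨1, (1, -1)⟩ →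
      (∀ v, (¬ ∃ k, s k = v) → f' (gen Γ v) = 1) → f = f' := by
    intro f' h0' h1' h2' hout'
    refine hom_ext fun v => ?_
    by_cases hv : ∃ k, s k = v
    · obtain ⟨k, rfl⟩ := hv
      fin_cases k
      exacts [h0.trans h0'.symm, h1.trans h1'.symm, h2.trans h2'.symm]
    · rw [hout v hv, hout' v hv]
  let ψ : FreeGroup Bool →* FreeGroup Bool := FreeGroup.lift fun k => wordAut (letterElt (k, true)) q
  have hψ : ∀ p, ψ.comp (wordAut p).toMonoidHom =
      (wordAut ((MonoidHom.id _) p)).toMonoidHom.comp ψ := fun p => by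
    ext k
    change ψ (wordAut p (of k)) = wordAut p (ψ (of k))
    have h3 : letterElt (letterPerm p (k, true)) = p * letterElt (k, true) := by
      revert p k
      decide
    rw [wordAut_of, lift_wordAut_mk_singleton hqq, lift_apply_of, h3, _root_.map_mul,
      MulAut.mul_apply]
  have hfψ : f = (SemidirectProduct.map ψ (MonoidHom.id _) hψ).comp (kleinProj s hs hind) := by
    refine hext _ ?_ ?_ ?_ fun v hv => ?_
    · rw [MonoidHom.comp_apply, kleinProj_gen_zero]
      have h3 : letterElt (true, true) = 1 := by decide
      ext <;> simp [ψ, h3]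
    · rw [MonoidHom.comp_apply, kleinProj_gen_one]
      ext <;> simp
    · rw [MonoidHom.comp_apply, kleinProj_gen_two]
      ext <;> simp
    · rw [MonoidHom.comp_apply, kleinProj, extendLift_gen_of_notMem hv, _root_.map_one]
  have hs' : Function.Surjective ψ := by
    intro g
    obtain ⟨x, hx⟩ := hf (SemidirectProduct.inl g)
    rw [hfψ] at hx
    exact ⟨_, (SemidirectProduct.ext_iff.mp hx).1⟩
  obtain ⟨p, hp⟩ := exists_wordAut_eq_of_surjective hqq hs'
  refine ⟨SemidirectProduct.inr p, hext _ ?_ ?_ ?_ fun v hv => ?_⟩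
  · rw [MonoidHom.comp_apply, kleinProj_gen_zero]
    ext <;> simp [hp, mul_comm]
  · rw [MonoidHom.comp_apply, kleinProj_gen_one]
    ext <;> simp [mul_comm]
  · rw [MonoidHom.comp_apply, kleinProj_gen_two]
    ext <;> simp [mul_comm]
  · rw [MonoidHom.comp_apply, kleinProj, extendLift_gen_of_notMem hv, _root_.map_one]

theorem exists_eq_conj_comp_kleinProj (hadj : Γ.Adj (s 1) (s 2)) {f : RACG Γ →* FreeKlein}
    (hf : Function.Surjective f) (hr : ∀ g, (f g).right = (kleinProj s hs hind g).right) :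
    ∃ d, f = (MulAut.conj d).toMonoidHom.comp (kleinProj s hs hind) := by
  have h1 : f (gen Γ (s 1)) = ⟨(f (gen Γ (s 1))).left, (-1, 1)⟩ :=
    SemidirectProduct.ext rfl (by rw [hr, kleinProj_gen_one])
  obtain ⟨h, hh⟩ : ∃ h : FreeGroup Bool, (f (gen Γ (s 1))).left = h * (wordAut (-1, 1) h)⁻¹ := by
    refine exists_eq_mul_inv_of_swap_eq_inv ?_
    have h3 := congrArg f (gen_mul_gen (Γ := Γ) (s 1))
    rw [_root_.map_mul, _root_.map_one] at h3
    have h4 := (SemidirectProduct.ext_iff.mp h3).1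
    rw [SemidirectProduct.mul_left, congrArg SemidirectProduct.right h1] at h4
    exact (inv_eq_of_mul_eq_one_right h4).symm
  let c : MulAut FreeKlein := MulAut.conj (SemidirectProduct.inl h)⁻¹
  let f' : RACG Γ →* FreeKlein := c.toMonoidHom.comp f
  have hf' : ∀ g, f' g = (SemidirectProduct.inl h)⁻¹ * f g * SemidirectProduct.inl h := fun g => by
    simp [f', c]
  have hr' : ∀ g, (f' g).right = (kleinProj s hs hind g).right := fun g => by
    rw [hf', ← hr]
    simp
  have h1' : f' (gen Γ (s 1)) = ⟨1, (-1, 1)⟩ := by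
    rw [hf', h1, hh]
    ext <;> simp
  have h2' : f' (gen Γ (s 2)) = ⟨1, (1, -1)⟩ := by
    have hright : (f' (gen Γ (s 2))).right = (1, -1) := by rw [hr', kleinProj_gen_two]
    refine SemidirectProduct.ext ?_ hright
    have h3 := ((commute_gen hadj).map f').eq
    rw [h1', mul_swap, swap_mul] at h3
    exact eq_one_of_swap_eq_self (SemidirectProduct.ext_iff.mp h3).1
  obtain ⟨d, hd⟩ := exists_eq_conj_comp_kleinProj_of_gen (f := f') (c.surjective.comp hf) hr' h1' h2'
  refine ⟨SemidirectProduct.inl h * d, MonoidHom.ext fun g => ?_⟩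
  have h3 := DFunLike.congr_fun hd g
  rw [hf'] at h3
  simp only [MonoidHom.comp_apply, MulEquiv.toMonoidHom_eq_coe, MonoidHom.coe_coe,
    MulAut.conj_apply] at h3 ⊢
  calc f g = SemidirectProduct.inl h * ((SemidirectProduct.inl h)⁻¹ * f g *
        SemidirectProduct.inl h) * (SemidirectProduct.inl h)⁻¹ := by group
    _ = _ := by
      rw [h3]
      group

theorem virtuallyManyQuasimorphisms_of_kleinProj [Finite V] (s : Fin 3 → V)
    (hs : Function.Injective s) (hind : ∀ k, ¬ Γ.Adj (s 0) (s k)) (hadj : Γ.Adj (s 1) (s 2)) :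
    VirtuallyManyQuasimorphisms (MulAut (RACG Γ)) := by
  let P := kleinProj s hs hind
  have hex : ∀ φ : torelli Γ, ∃ d, P.comp φ.1.toMonoidHom = (MulAut.conj d).toMonoidHom.comp P := by
    intro φ
    have hsurj := kleinProj_surjective (hs := hs) (hind := hind)
    refine exists_eq_conj_comp_kleinProj hadj (hsurj.comp φ.1.surjective) fun g => ?_
    refine Prod.ext ?_ ?_
    · exact φ.2 ((MonoidHom.fst ℤˣ ℤˣ).comp (SemidirectProduct.rightHom.comp P)) g
    · exact φ.2 ((MonoidHom.snd ℤˣ ℤˣ).comp (SemidirectProduct.rightHom.comp P)) g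
  have huniq : ∀ d d' : FreeKlein, (MulAut.conj d).toMonoidHom.comp P =
      (MulAut.conj d').toMonoidHom.comp P → d = d' := by
    intro d d' h
    refine conj_injective (MulEquiv.ext fun x => ?_)
    obtain ⟨y, rfl⟩ := kleinProj_surjective (hs := hs) (hind := hind) x
    exact DFunLike.congr_fun h y
  choose D hD using hex
  let θ : torelli Γ →* FreeKlein := MonoidHom.mk' D fun φ ψ => by
    refine huniq _ _ (MonoidHom.ext fun g => ?_)
    rw [← hD]
    have h1 := DFunLike.congr_fun (hD φ) (ψ.1 g)
    have h2 := DFunLike.congr_fun (hD ψ) g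
    simp only [MonoidHom.comp_apply, MulEquiv.toMonoidHom_eq_coe, MonoidHom.coe_coe] at h1 h2 ⊢
    rw [_root_.map_mul, MulAut.mul_apply, ← h2, ← h1]
    rfl
  have hθ : ∀ (g : RACG Γ) (h : MulAut.conj g ∈ torelli Γ), θ ⟨MulAut.conj g, h⟩ = P g := by
    intro g h
    refine huniq _ _ ?_
    refine (hD _).symm.trans (MonoidHom.ext fun x => ?_)
    simp
  let H := (torelli Γ).kerOn (SemidirectProduct.rightHom.comp θ)
  have hH : ∀ x : H, ∃ h : x.1 ∈ torelli Γ, (θ ⟨x.1, h⟩).right = 1 := fun x =>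
    Subgroup.mem_kerOn.mp x.2
  let θ' : H →* FreeGroup Bool :=
    { toFun := fun x => (θ ⟨x.1, (hH x).1⟩).left
      map_one' := congrArg SemidirectProduct.left (_root_.map_one θ)
      map_mul' := fun x y => by
        have h := _root_.map_mul θ ⟨x.1, (hH x).1⟩ ⟨y.1, (hH y).1⟩
        refine (congrArg SemidirectProduct.left h).trans ?_
        rw [SemidirectProduct.mul_left, (hH x).2, _root_.map_one, MulAut.one_apply] }
  refine virtuallyManyQuasimorphisms_of_hom H θ' fun w => ⟨1, one_ne_zero, ?_⟩
  obtain ⟨g, hg⟩ := kleinProj_surjective (hs := hs) (hind := hind) (SemidirectProduct.inl w)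
  have hg' := hθ g (conj_mem_torelli g)
  refine ⟨⟨MulAut.conj g, Subgroup.mem_kerOn.mpr ⟨conj_mem_torelli g, ?_⟩⟩, ?_⟩
  · rw [MonoidHom.comp_apply, hg']
    exact congrArg SemidirectProduct.right hg
  · rw [pow_one]
    exact congrArg SemidirectProduct.left (hg'.trans hg)

end RACG

namespace Matrix

/-- The elementary matrices generating the Sanov subgroup. -/
def sanovGen (k : Bool) : (Matrix (Fin 2) (Fin 2) ℤ)ˣ :=
  if k then
    ⟨!![1, 2; 0, 1], !![1, -2; 0, 1], by decide, by decide⟩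
  else
    ⟨!![1, 0; 2, 1], !![1, 0; -2, 1], by decide, by decide⟩

theorem sanovGen_true_zpow (n : ℤ) :
    ((sanovGen true ^ n : (Matrix (Fin 2) (Fin 2) ℤ)ˣ) : Matrix (Fin 2) (Fin 2) ℤ) =
      !![1, 2 * n; 0, 1] := by
  induction n with
  | zero => ext i j; fin_cases i <;> fin_cases j <;> rfl
  | succ n ih =>
    rw [_root_.zpow_add_one, Units.val_mul, ih]
    simp [sanovGen, mul_add, add_comm]
  | pred n ih =>
    rw [_root_.zpow_sub_one, Units.val_mul, ih]
    simp [sanovGen, mul_sub]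
    ring

theorem sanovGen_true_mul (M : (Matrix (Fin 2) (Fin 2) ℤ)ˣ) (n : ℤ) :
    ((sanovGen true ^ n * M : (Matrix (Fin 2) (Fin 2) ℤ)ˣ) : Matrix (Fin 2) (Fin 2) ℤ) =
      !![M.1 0 0 + 2 * n * M.1 1 0, M.1 0 1 + 2 * n * M.1 1 1; M.1 1 0, M.1 1 1] := by
  rw [Units.val_mul, sanovGen_true_zpow]
  ext i j
  fin_cases i <;> fin_cases j <;> simp [Matrix.mul_apply]

theorem sanovGen_false_zpow (n : ℤ) :
    ((sanovGen false ^ n : (Matrix (Fin 2) (Fin 2) ℤ)ˣ) : Matrix (Fin 2) (Fin 2) ℤ) =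
      !![1, 0; 2 * n, 1] := by
  induction n with
  | zero => ext i j; fin_cases i <;> fin_cases j <;> rfl
  | succ n ih =>
    rw [_root_.zpow_add_one, Units.val_mul, ih]
    simp [sanovGen, mul_add]
  | pred n ih =>
    rw [_root_.zpow_sub_one, Units.val_mul, ih]
    simp [sanovGen, mul_sub]
    ring

theorem sanovGen_false_mul (M : (Matrix (Fin 2) (Fin 2) ℤ)ˣ) (n : ℤ) :
    ((sanovGen false ^ n * M : (Matrix (Fin 2) (Fin 2) ℤ)ˣ) : Matrix (Fin 2) (Fin 2) ℤ) =
      !![M.1 0 0, M.1 0 1; M.1 1 0 + 2 * n * M.1 0 0, M.1 1 1 + 2 * n * M.1 0 1] := by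
  rw [Units.val_mul, sanovGen_false_zpow]
  ext i j
  fin_cases i <;> fin_cases j <;> simp [Matrix.mul_apply] <;> ring

/-- The homomorphism from the free group onto the Sanov subgroup. -/
def sanovHom : FreeGroup Bool →* (Matrix (Fin 2) (Fin 2) ℤ)ˣ :=
  FreeGroup.lift sanovGen

theorem col_ne_zero (M : (Matrix (Fin 2) (Fin 2) ℤ)ˣ) (h0 : M.1 0 0 = 0) (h1 : M.1 1 0 = 0) :
    False := by
  have h : IsUnit M.1.det := (Matrix.isUnit_iff_isUnit_det _).mp M.isUnit
  rw [Matrix.det_fin_two, h0, h1, zero_mul, mul_zero, sub_zero] at h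
  exact not_isUnit_zero h

open scoped Pointwise in
theorem sanovHom_injective : Function.Injective sanovHom := by
  let G := (Matrix (Fin 2) (Fin 2) ℤ)ˣ
  let X : Bool → Set G := fun k =>
    if k then {M | M.1 1 0 ^ 2 ≤ M.1 0 0 * M.1 1 0}
    else {M | M.1 0 0 = 0 ∨ M.1 0 0 ^ 2 < M.1 0 0 * M.1 1 0}
  let Y : Bool → Set G := fun k =>
    if k then {M | M.1 0 0 * M.1 1 0 < - M.1 1 0 ^ 2}
    else {M | M.1 0 0 ≠ 0 ∧ M.1 0 0 * M.1 1 0 ≤ - M.1 0 0 ^ 2}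
  have hXX : Disjoint (X true) (X false) := Set.disjoint_left.mpr fun M h1 h2 => by
    simp only [X, if_true, Bool.false_eq_true, if_false, Set.mem_ofPred_eq] at h1 h2
    rcases h2 with h2 | h2
    · rw [h2, zero_mul] at h1
      exact col_ne_zero M h2 (pow_eq_zero_iff two_ne_zero |>.mp (le_antisymm h1 (sq_nonneg _)))
    · nlinarith [sq_nonneg (M.1 0 0 - M.1 1 0)]
  have hYY : Disjoint (Y true) (Y false) := Set.disjoint_left.mpr fun M h1 h2 => by
    simp only [Y, if_true, Bool.false_eq_true, if_false, Set.mem_ofPred_eq] at h1 h2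
    nlinarith [sq_nonneg (M.1 0 0 + M.1 1 0)]
  refine FreeGroup.injective_lift_of_ping_pong sanovGen X Y ?_ ?_ ?_ ?_ ?_ ?_
  · rintro (_ | _)
    · exact ⟨sanovGen false, by right; decide⟩
    · exact ⟨1, by simp [X]⟩
  · rintro (_ | _) (_ | _) h
    exacts [absurd rfl h, hXX.symm, hXX, absurd rfl h]
  · rintro (_ | _) (_ | _) h
    exacts [absurd rfl h, hYY.symm, hYY, absurd rfl h]
  · rintro (_ | _) (_ | _) <;> refine Set.disjoint_left.mpr fun M h1 h2 => ?_
    · simp only [X, Y, Bool.false_eq_true, if_false, Set.mem_ofPred_eq] at h1 h2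
      rcases h1 with h1 | h1
      · exact h2.1 h1
      · nlinarith [sq_nonneg (M.1 0 0)]
    · simp only [X, Y, Bool.false_eq_true, if_false, if_true, Set.mem_ofPred_eq] at h1 h2
      rcases h1 with h1 | h1
      · rw [h1] at h2
        nlinarith [sq_nonneg (M.1 1 0)]
      · nlinarith [sq_nonneg (M.1 0 0), sq_nonneg (M.1 1 0)]
    · simp only [X, Y, Bool.false_eq_true, if_false, if_true, Set.mem_ofPred_eq] at h1 h2
      have := pow_pos (abs_pos.mpr h2.1) 2
      rw [sq_abs] at this
      nlinarith [sq_nonneg (M.1 1 0)]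
    · simp only [X, Y, if_true, Set.mem_ofPred_eq] at h1 h2
      nlinarith [sq_nonneg (M.1 1 0)]
  · rintro (_ | _) _ ⟨M, hM, rfl⟩
    · have h := sanovGen_false_mul M 1
      rw [zpow_one] at h
      simp only [X, Y, Bool.false_eq_true, if_false, Set.mem_ofPred_eq, Set.mem_compl_iff,
        smul_eq_mul] at hM ⊢
      simp only [h, Matrix.of_apply, Matrix.cons_val]
      by_cases h0 : M.1 0 0 = 0
      · exact Or.inl h0
      · right
        by_contra hc
        exact hM ⟨h0, by nlinarith⟩
    · have h := sanovGen_true_mul M 1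
      rw [zpow_one] at h
      simp only [X, Y, if_true, Set.mem_ofPred_eq, Set.mem_compl_iff, smul_eq_mul] at hM ⊢
      simp only [h, Matrix.of_apply, Matrix.cons_val]
      nlinarith
  · rintro (_ | _) _ ⟨M, hM, rfl⟩
    · have h := sanovGen_false_mul M (-1)
      rw [_root_.zpow_neg_one] at h
      simp only [X, Y, Bool.false_eq_true, if_false, Set.mem_ofPred_eq, Set.mem_compl_iff,
        smul_eq_mul, Pi.inv_apply] at hM ⊢
      simp only [h, Matrix.of_apply, Matrix.cons_val]
      rw [not_or] at hM
      exact ⟨hM.1, by nlinarith [hM.2]⟩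
    · have h := sanovGen_true_mul M (-1)
      rw [_root_.zpow_neg_one] at h
      simp only [X, Y, if_true, Set.mem_ofPred_eq, Set.mem_compl_iff, smul_eq_mul,
        Pi.inv_apply] at hM ⊢
      simp only [h, Matrix.of_apply, Matrix.cons_val]
      nlinarith

theorem mem_range_sanovHom (M : (Matrix (Fin 2) (Fin 2) ℤ)ˣ) (hdet : M.1.det = 1)
    (h00 : M.1 0 0 % 4 = 1) (h01 : M.1 0 1 % 2 = 0) (h10 : M.1 1 0 % 2 = 0) :
    M ∈ sanovHom.range := by
  have hgen : ∀ k, sanovGen k ∈ sanovHom.range := fun k => ⟨FreeGroup.of k, by simp [sanovHom]⟩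
  induction hn : (M.1 0 0).natAbs + (M.1 1 0).natAbs using Nat.strong_induction_on generalizing M with
  | _ n ih =>
    rw [Matrix.det_fin_two] at hdet
    have hred : ∀ (k : Bool) (m : ℤ), sanovGen k ^ m * M ∈ sanovHom.range →
        M ∈ sanovHom.range := fun k m h =>
      (Subgroup.mul_mem_cancel_left _ (zpow_mem (hgen k) m)).mp h
    have hdet' : ∀ k, ∀ m : ℤ, (sanovGen k ^ m * M).1.det = 1 := by
      rintro (_ | _) m
      · rw [sanovGen_false_mul, Matrix.det_fin_two_of, ← hdet]
        ring
      · rw [sanovGen_true_mul, Matrix.det_fin_two_of, ← hdet]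
        ring
    rcases eq_or_ne (M.1 1 0) 0 with h0 | h0
    · have h1 : M.1 0 0 = 1 ∧ M.1 1 1 = 1 := by
        rw [h0, mul_zero, sub_zero] at hdet
        rcases Int.mul_eq_one_iff_eq_one_or_neg_one.mp hdet with h | h
        · exact h
        · omega
      have h2 : M = sanovGen true ^ (M.1 0 1 / 2) := by
        refine Units.ext ?_
        rw [sanovGen_true_zpow, Matrix.eta_fin_two M.1, h0, h1.1, h1.2]
        have : 2 * (M.1 0 1 / 2) = M.1 0 1 := by omega
        simp only [Matrix.of_apply, Matrix.cons_val]
        rw [this]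
      rw [h2]
      exact zpow_mem (hgen true) _
    have main : ∀ (k : Bool) (m : ℤ), (sanovGen k ^ m * M).1 0 0 % 4 = 1 →
        (sanovGen k ^ m * M).1 0 1 % 2 = 0 → (sanovGen k ^ m * M).1 1 0 % 2 = 0 →
        ((sanovGen k ^ m * M).1 0 0).natAbs + ((sanovGen k ^ m * M).1 1 0).natAbs < n →
        M ∈ sanovHom.range := fun k m h1 h2 h3 h4 =>
      hred k m (ih _ h4 _ (hdet' k m) h1 h2 h3 rfl)
    have hA : ∀ m : ℤ, m = 1 ∨ m = -1 → (M.1 0 0 + 2 * m * M.1 1 0).natAbs < (M.1 0 0).natAbs →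
        M ∈ sanovHom.range := by
      intro m hm h
      have h1 := sanovGen_true_mul M m
      refine main true m ?_ ?_ ?_ ?_ <;> simp only [h1, Matrix.of_apply, Matrix.cons_val]
      · rcases hm with rfl | rfl <;> omega
      · rcases hm with rfl | rfl <;> omega
      · exact h10
      · omega
    have hB : ∀ m : ℤ, m = 1 ∨ m = -1 → (M.1 1 0 + 2 * m * M.1 0 0).natAbs < (M.1 1 0).natAbs →
        M ∈ sanovHom.range := by
      intro m hm h
      have h1 := sanovGen_false_mul M m
      refine main false m ?_ ?_ ?_ ?_ <;> simp only [h1, Matrix.of_apply, Matrix.cons_val]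
      · exact h00
      · exact h01
      · rcases hm with rfl | rfl <;> omega
      · omega
    generalize M.1 0 0 = a at *
    generalize M.1 1 0 = b at *
    by_cases hsgn : 0 < a ↔ 0 < b
    · rcases lt_or_ge b.natAbs a.natAbs with hab | hab
      · exact hA (-1) (Or.inr rfl) (by omega)
      · exact hB (-1) (Or.inr rfl) (by omega)
    · rcases lt_or_ge b.natAbs a.natAbs with hab | hab
      · exact hA 1 (Or.inl rfl) (by omega)
      · exact hB 1 (Or.inl rfl) (by omega)

end Matrix

namespace RACG

variable {V : Type*} {Γ : SimpleGraph V}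

open Classical in
/-- The endomorphism conjugating the generator `x` by the generator `y` and fixing the other
generators. -/
noncomputable def partialConjHom (x y : V) (hxy : ∀ z, Γ.Adj x z → Γ.Adj y z) :
    RACG Γ →* RACG Γ :=
  lift (Function.update (gen Γ) x (gen Γ y * gen Γ x * gen Γ y))
    (fun v => by
      rcases eq_or_ne v x with rfl | hv
      · rw [Function.update_self]
        calc _ = gen Γ y * (gen Γ v * (gen Γ y * gen Γ y) * gen Γ v) * gen Γ y := by group
          _ = 1 := by simp
      · rw [Function.update_of_ne hv, gen_mul_gen])
    (fun u v huv => by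
      have key : ∀ z, Γ.Adj x z → Commute (gen Γ y * gen Γ x * gen Γ y) (gen Γ z) := fun z hz =>
        ((commute_gen (hxy z hz)).mul_left (commute_gen hz)).mul_left (commute_gen (hxy z hz))
      rcases eq_or_ne u x with rfl | hu
      · rw [Function.update_self, Function.update_of_ne huv.ne']
        exact key _ huv
      · rcases eq_or_ne v x with rfl | hv
        · rw [Function.update_self, Function.update_of_ne hu]
          exact (key _ huv.symm).symm
        · rw [Function.update_of_ne hu, Function.update_of_ne hv]
          exact commute_gen huv)

section

variable {x y : V} {hxy : ∀ z, Γ.Adj x z → Γ.Adj y z}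

open Classical in
theorem partialConjHom_gen_self :
    partialConjHom x y hxy (gen Γ x) = gen Γ y * gen Γ x * gen Γ y := by
  rw [partialConjHom, lift_gen, Function.update_self]

open Classical in
theorem partialConjHom_gen_of_ne {v : V} (hv : v ≠ x) :
    partialConjHom x y hxy (gen Γ v) = gen Γ v := by
  rw [partialConjHom, lift_gen, Function.update_of_ne hv]

theorem partialConjHom_comp_self (hne : x ≠ y) :
    (partialConjHom x y hxy).comp (partialConjHom x y hxy) = MonoidHom.id _ := by
  refine hom_ext fun v => ?_
  rw [MonoidHom.comp_apply, MonoidHom.id_apply]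
  rcases eq_or_ne v x with rfl | hv
  · rw [partialConjHom_gen_self, map_mul, map_mul, partialConjHom_gen_self,
      partialConjHom_gen_of_ne hne.symm]
    calc _ = (gen Γ y * gen Γ y) * gen Γ v * (gen Γ y * gen Γ y) := by group
      _ = gen Γ v := by simp
  · rw [partialConjHom_gen_of_ne hv, partialConjHom_gen_of_ne hv]

variable (hxy) in
/-- The partial conjugation of the generator `x` by the generator `y`, as an element of the
Torelli subgroup. -/
noncomputable def partialConj (hne : x ≠ y) : torelli Γ :=
  ⟨MonoidHom.toMulEquiv _ _ (partialConjHom_comp_self (hxy := hxy) hne)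
    (partialConjHom_comp_self hne), fun χ g => by
      refine DFunLike.congr_fun (f := χ.comp (partialConjHom x y hxy)) (hom_ext fun v => ?_) g
      rw [MonoidHom.comp_apply]
      rcases eq_or_ne v x with rfl | hv
      · rw [partialConjHom_gen_self, map_mul, map_mul, mul_right_comm, ← map_mul, gen_mul_gen,
          map_one, one_mul]
      · rw [partialConjHom_gen_of_ne hv]⟩

theorem partialConj_gen_self (hne : x ≠ y) :
    (partialConj hxy hne).1 (gen Γ x) = gen Γ y * gen Γ x * gen Γ y :=
  partialConjHom_gen_self (hxy := hxy)

theorem partialConj_gen_of_ne (hne : x ≠ y) {v : V} (hv : v ≠ x) :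
    (partialConj hxy hne).1 (gen Γ v) = gen Γ v :=
  partialConjHom_gen_of_ne (hxy := hxy) hv

end

theorem exists_latticeHom_eq_sanovGen (s : Option (Fin 2) → V) (hs : Function.Injective s)
    (hind : ∀ k l, ¬ Γ.Adj (s k) (s l))
    (htwin : ∀ k l z, Γ.Adj (s k) z → Γ.Adj (s l) z) (b : Bool) :
    ∃ φ : torelli Γ, latticeHom s hs hind φ = Matrix.sanovGen b := by
  let i : Fin 2 := if b then 0 else 1
  have hne : s (some i) ≠ s none := fun h => Option.some_ne_none _ (hs h)
  refine ⟨partialConj (htwin (some i) none) hne * partialConj (htwin none (some i)) hne.symm, ?_⟩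
  rw [map_mul]
  have h01 : s (some 0) ≠ s (some 1) := fun h => by simpa using hs h
  have h0 : s (some 0) ≠ s none := fun h => by simpa using hs h
  have h1 : s (some 1) ≠ s none := fun h => by simpa using hs h
  have hA : latticeHom s hs hind (partialConj (htwin (some i) none) hne) =
      if b then !![-1, 0; 0, 1] else !![1, 0; 0, -1] := by
    ext j k
    change (latticeProj s hs hind ((partialConj _ hne).1 (gen Γ (s (some k)) * gen Γ (s none)))).vec
      j = _
    rw [map_mul, partialConj_gen_of_ne hne hne.symm]
    by_cases hk : k = i
    · subst hk
      rw [partialConj_gen_self]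
      cases b <;> fin_cases j <;> simp [i]
    · rw [partialConj_gen_of_ne hne fun h => hk (Option.some_injective _ (hs h))]
      cases b <;> fin_cases k <;> fin_cases j <;> simp [i] at hk ⊢
  have hB : latticeHom s hs hind (partialConj (htwin none (some i)) hne.symm) =
      if b then !![-1, -2; 0, 1] else !![1, 0; -2, -1] := by
    ext j k
    change (latticeProj s hs hind ((partialConj _ hne.symm).1
      (gen Γ (s (some k)) * gen Γ (s none)))).vec j = _
    rw [map_mul, partialConj_gen_self, partialConj_gen_of_ne hne.symm
      fun h => Option.some_ne_none _ (hs h)]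
    cases b <;> fin_cases k <;> fin_cases j <;> simp [i]
  rw [hA, hB]
  cases b <;> simp [Matrix.sanovGen]

theorem virtuallyManyQuasimorphisms_of_twins [Finite V] (s : Option (Fin 2) → V)
    (hs : Function.Injective s) (hind : ∀ k l, ¬ Γ.Adj (s k) (s l))
    (htwin : ∀ k l z, Γ.Adj (s k) z → Γ.Adj (s l) z) :
    VirtuallyManyQuasimorphisms (MulAut (RACG Γ)) := by
  let ρ : torelli Γ →* (Matrix (Fin 2) (Fin 2) ℤ)ˣ := (latticeHom s hs hind).toHomUnits
  let r : (Matrix (Fin 2) (Fin 2) ℤ)ˣ →* (Matrix (Fin 2) (Fin 2) (ZMod 4))ˣ :=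
    Units.map (Int.castRingHom (ZMod 4)).mapMatrix.toMonoidHom
  choose α hα using exists_latticeHom_eq_sanovGen s hs hind htwin
  have hρ : ρ.comp (FreeGroup.lift α) = Matrix.sanovHom := by
    refine FreeGroup.ext_hom _ _ fun b => Units.ext ?_
    simpa [ρ, Matrix.sanovHom] using hα b
  let H := (torelli Γ).kerOn (r.comp ρ)
  have hH : ∀ x : H, ∃ h : x.1 ∈ torelli Γ, r (ρ ⟨x.1, h⟩) = 1 := fun x =>
    Subgroup.mem_kerOn.mp x.2
  let ρ' : H →* (Matrix (Fin 2) (Fin 2) ℤ)ˣ :=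
    ρ.comp (Subgroup.inclusion fun x hx => (Subgroup.mem_kerOn.mp hx).1)
  have hρ' : ∀ x, ρ' x ∈ Matrix.sanovHom.range := by
    intro x
    have hx : r (ρ' x) = 1 := (hH x).2
    have hmod : ∀ i j, ((ρ' x).1 i j : ZMod 4) = (1 : Matrix (Fin 2) (Fin 2) (ZMod 4)) i j :=
      fun i j => congrArg (fun M : (Matrix (Fin 2) (Fin 2) (ZMod 4))ˣ => M.1 i j) hx
    have h00 : (ρ' x).1 0 0 % 4 = 1 :=
      (ZMod.intCast_eq_intCast_iff' _ 1 4).mp (by simpa using hmod 0 0)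
    have h11 : (ρ' x).1 1 1 % 4 = 1 :=
      (ZMod.intCast_eq_intCast_iff' _ 1 4).mp (by simpa using hmod 1 1)
    have h01 : (ρ' x).1 0 1 % 4 = 0 :=
      (ZMod.intCast_eq_intCast_iff' _ 0 4).mp (by simpa using hmod 0 1)
    have h10 : (ρ' x).1 1 0 % 4 = 0 :=
      (ZMod.intCast_eq_intCast_iff' _ 0 4).mp (by simpa using hmod 1 0)
    refine Matrix.mem_range_sanovHom _ ?_ h00 (by omega) (by omega)
    rcases Int.isUnit_iff.mp ((Matrix.isUnit_iff_isUnit_det _).mp (ρ' x).isUnit) with h | h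
    · exact h
    · rw [Matrix.det_fin_two] at h
      have h2 : ((ρ' x).1 0 0 * (ρ' x).1 1 1) % 4 = 1 := by rw [Int.mul_emod, h00, h11]; rfl
      have h3 : ((ρ' x).1 0 1 * (ρ' x).1 1 0) % 4 = 0 := by rw [Int.mul_emod, h01, h10]; rfl
      omega
  let e := MonoidHom.ofInjective Matrix.sanovHom_injective
  refine virtuallyManyQuasimorphisms_of_hom H
    (e.symm.toMonoidHom.comp (ρ'.codRestrict _ hρ')) fun w =>
      ⟨Nat.card (Matrix (Fin 2) (Fin 2) (ZMod 4))ˣ, Nat.card_pos.ne', ?_⟩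
  set n := Nat.card (Matrix (Fin 2) (Fin 2) (ZMod 4))ˣ
  refine ⟨⟨(FreeGroup.lift α w ^ n : torelli Γ), Subgroup.mem_kerOn.mpr ⟨SetLike.coe_mem _, ?_⟩⟩, ?_⟩
  · exact (map_pow (r.comp ρ) _ n).trans (pow_card_eq_one' ..)
  · refine e.symm_apply_eq.mpr (Subtype.ext ?_)
    change ρ (FreeGroup.lift α w ^ n) = Matrix.sanovHom (w ^ n)
    rw [← hρ, ← map_pow]
    rfl

end RACG

/-- `Aut(C_Γ)` virtually has many quasimorphisms iff some vertex of `Γ` is non-adjacent to at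
least two other vertices. -/
theorem racg_aut_virtuallyManyQuasimorphisms_iff {V : Type} [Fintype V] (Γ : SimpleGraph V) :
    VirtuallyManyQuasimorphisms (MulAut (RACG Γ)) ↔ HasVertexWithTwoNonNeighbors Γ := by
  refine ⟨not_imp_not.mp RACG.not_virtuallyManyQuasimorphisms, ?_⟩
  rintro ⟨u, v, w, hvw, hvu, hwu, huv, huw⟩
  have klein : ∀ a b c : V, a ≠ b → a ≠ c → ¬ Γ.Adj a b → ¬ Γ.Adj a c → Γ.Adj b c →
      VirtuallyManyQuasimorphisms (MulAut (RACG Γ)) := by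
    intro a b c hab hac h1 h2 h3
    refine RACG.virtuallyManyQuasimorphisms_of_kleinProj ![a, b, c] ?_ ?_ h3
    · intro i j
      fin_cases i <;> fin_cases j <;> simp [hab, hac, hab.symm, hac.symm, h3.ne, h3.ne']
    · intro k
      fin_cases k <;> simp [h1, h2]
  by_cases hadj : Γ.Adj v w
  · exact klein u v w hvu.symm hwu.symm huv huw hadj
  by_cases hall : ∃ a b c : V, a ≠ b ∧ a ≠ c ∧ ¬ Γ.Adj a b ∧ ¬ Γ.Adj a c ∧ Γ.Adj b c
  · obtain ⟨a, b, c, hab, hac, h1, h2, h3⟩ := hall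
    exact klein a b c hab hac h1 h2 h3
  have hind : ∀ k l : Option (Fin 2), ¬ Γ.Adj (k.elim w ![u, v]) (l.elim w ![u, v]) := by
    have h1 := mt Γ.adj_symm huv
    have h2 := mt Γ.adj_symm huw
    have h3 := mt Γ.adj_symm hadj
    rintro (_ | k) (_ | l)
    · simp
    · fin_cases l <;> simpa
    · fin_cases k <;> simpa
    · fin_cases k <;> fin_cases l <;> simp [huv, h1]
  refine RACG.virtuallyManyQuasimorphisms_of_twins (fun k => k.elim w ![u, v]) ?_ hind ?_
  · rintro (_ | k) (_ | l)
    · simp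
    · fin_cases l <;> simp [hwu, hvw.symm]
    · fin_cases k <;> simp [hwu.symm, hvw]
    · fin_cases k <;> fin_cases l <;> simp [hvu, hvu.symm]
  · intro k l z hz
    by_contra hc
    refine hall ⟨_, z, _, ?_, ?_, hc, hind l k, hz.symm⟩
    · rintro rfl
      exact hind k l hz
    · intro h
      exact hc (h ▸ hz)
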